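/- arXiv:0707.4329 — 2 statements merged into one kernel-verified Lean document; each statement's English description precedes it below -/
import Mathlib

section
/- Let i be a non-negative integer with i < n+1. Then every k-jet w ∈ Σ^i(n+1,p+1) admits a k-jet z ∈ Σ^i(n,p) such that w lies in the K-orbit of i_{+1}(z). -/
open scoped Topology unitInterval
open Filter Asymptotics
open scoped Manifold

namespace AndoCob


/-! ### Jet spaces -/

/-- The space of `k`-jets at the origin of smooth map germs `(ℝⁿ,0) → (ℝᵖ,0)`,
modeled by `p`-tuples of real polynomials in `n` variables with vanishing constant
term and total degree at most `k`.  This realizes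
`J^k(n,p) = ⊕_{i=1}^k Hom(Sⁱ(ℝⁿ), ℝᵖ)`. -/
def JetSpace (k n p : ℕ) : Type :=
  { z : Fin p → MvPolynomial (Fin n) ℝ //
    ∀ j, (z j).totalDegree ≤ k ∧ MvPolynomial.constantCoeff (z j) = 0 }

/-- The (finitely many) coefficients of a jet. -/
noncomputable def jetCoeffs {k n p : ℕ} (z : JetSpace k n p) :
    Fin p → (Fin n → Fin (k + 1)) → ℝ := fun j e =>
  MvPolynomial.coeff (Finsupp.equivFunOnFinite.symm fun i => (e i : ℕ)) (z.1 j)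

/-- The (euclidean) topology on a jet space, induced by the coefficients. -/
noncomputable instance {k n p : ℕ} : TopologicalSpace (JetSpace k n p) :=
  TopologicalSpace.induced jetCoeffs inferInstance

/-- Evaluation of the polynomial representative of a jet. -/
noncomputable def JetSpace.eval {k n p : ℕ} (z : JetSpace k n p) (x : Fin n → ℝ) :
    Fin p → ℝ := fun j => MvPolynomial.eval x (z.1 j)

/-- `z` is the `k`-jet at `0` of the map `f` : `f` agrees with the polynomial
representative of `z` to order `> k` at the origin. -/
def IsJetAt {k n p : ℕ} (z : JetSpace k n p) (f : (Fin n → ℝ) → Fin p → ℝ) : Prop :=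
  (fun x => f x - z.eval x) =o[𝓝 (0 : Fin n → ℝ)] fun x => ‖x‖ ^ k

/-- `z` is the `k`-jet at `0` of `f` along the set `s` (for manifolds with boundary). -/
def IsJetWithinAt {k n p : ℕ} (z : JetSpace k n p) (f : (Fin n → ℝ) → Fin p → ℝ)
    (s : Set (Fin n → ℝ)) : Prop :=
  (fun x => f x - z.eval x) =o[𝓝[s] (0 : Fin n → ℝ)] fun x => ‖x‖ ^ k

/-! ### Germs at the origin, diffeomorphism germs, contact equivalence -/

/-- `f` is smooth on a neighbourhood of the origin. -/
def SmoothGermAtZero {n p : ℕ} (f : (Fin n → ℝ) → Fin p → ℝ) : Prop :=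
  ∃ U ∈ 𝓝 (0 : Fin n → ℝ), ContDiffOn ℝ (⊤ : ℕ∞) f U

/-- `h` is (a representative of) a germ of diffeomorphism of `(ℝⁿ,0)`:
it fixes the origin, is smooth near the origin and its differential at the
origin is invertible (by the inverse function theorem this is equivalent to
being a diffeomorphism germ). -/
def DiffeoGermAtZero {n : ℕ} (h : (Fin n → ℝ) → Fin n → ℝ) : Prop :=
  h 0 = 0 ∧ SmoothGermAtZero h ∧ Function.Bijective (fderiv ℝ h 0)

/-- Contact (Mather's group `𝒦`) equivalence of two map germs:
`g x = M x • f (h x)` near the origin, for a diffeomorphism germ `h` of the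
source and a smooth germ `M` of invertible matrices. -/
def KEquivGerm {n p : ℕ} (f g : (Fin n → ℝ) → Fin p → ℝ) : Prop :=
  ∃ (h : (Fin n → ℝ) → Fin n → ℝ) (M : (Fin n → ℝ) → Matrix (Fin p) (Fin p) ℝ),
    DiffeoGermAtZero h ∧
    (∃ U ∈ 𝓝 (0 : Fin n → ℝ), ContDiffOn ℝ (⊤ : ℕ∞) (fun x (i : Fin p) (j : Fin p) => M x i j) U) ∧
    IsUnit (M 0) ∧
    (∀ᶠ x in 𝓝 (0 : Fin n → ℝ), g x = (M x).mulVec (f (h x)))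

/-- Contact equivalence of `k`-jets: the jets admit smooth representatives
that are `𝒦`-equivalent as germs. -/
def KEquiv {k n p : ℕ} (z w : JetSpace k n p) : Prop :=
  ∃ f g : (Fin n → ℝ) → Fin p → ℝ,
    SmoothGermAtZero f ∧ SmoothGermAtZero g ∧ f 0 = 0 ∧ g 0 = 0 ∧
    IsJetAt z f ∧ IsJetAt w g ∧ KEquivGerm f g

/-- The `𝒦`-orbit of a jet. -/
def KOrbit {k n p : ℕ} (z : JetSpace k n p) : Set (JetSpace k n p) := {w | KEquiv z w}

/-- A set of jets invariant under the contact group. -/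
def KInvariant {k n p : ℕ} (Ω : Set (JetSpace k n p)) : Prop :=
  ∀ z ∈ Ω, ∀ w, KEquiv z w → w ∈ Ω

/-- Right-left equivalence of jets (the action of `L^k(p) × L^k(n)`):
the jets admit smooth representatives `f`, `g` with `g = ψ ∘ f ∘ φ` near `0`
for diffeomorphism germs `φ` of `(ℝⁿ,0)` and `ψ` of `(ℝᵖ,0)`. -/
def RLEquiv {k n p : ℕ} (z w : JetSpace k n p) : Prop :=
  ∃ (f g : (Fin n → ℝ) → Fin p → ℝ) (φ : (Fin n → ℝ) → Fin n → ℝ)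
    (ψ : (Fin p → ℝ) → Fin p → ℝ),
    SmoothGermAtZero f ∧ SmoothGermAtZero g ∧ f 0 = 0 ∧ g 0 = 0 ∧
    DiffeoGermAtZero φ ∧ DiffeoGermAtZero ψ ∧
    IsJetAt z f ∧ IsJetAt w g ∧ (∀ᶠ x in 𝓝 (0 : Fin n → ℝ), g x = ψ (f (φ x)))

/-- Invariance under the action of `L^k(p) × L^k(n)`. -/
def LInvariant {k n p : ℕ} (Ω : Set (JetSpace k n p)) : Prop :=
  ∀ z ∈ Ω, ∀ w, RLEquiv z w → w ∈ Ω



/-! ### Truncation and algebraic operations on jets -/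

/-- Truncation of a polynomial: keep only the monomials of degree between `1` and `k`. -/
noncomputable def truncPoly (k : ℕ) {n : ℕ} (φ : MvPolynomial (Fin n) ℝ) :
    MvPolynomial (Fin n) ℝ :=
  ∑ d ∈ φ.support.filter fun d : Fin n →₀ ℕ =>
      1 ≤ (d.sum fun _ e => e) ∧ (d.sum fun _ e => e) ≤ k,
    MvPolynomial.monomial d (MvPolynomial.coeff d φ)

theorem truncPoly_totalDegree_le (k : ℕ) {n : ℕ} (φ : MvPolynomial (Fin n) ℝ) :
    (truncPoly k φ).totalDegree ≤ k := by
  classical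
  refine le_trans (MvPolynomial.totalDegree_finset_sum _ _) ?_
  refine Finset.sup_le fun d hd => ?_
  simp only [Finset.mem_filter] at hd
  refine le_trans (MvPolynomial.totalDegree_monomial_le _ _) ?_
  simpa [Finsupp.sum] using hd.2.2

theorem truncPoly_constantCoeff (k : ℕ) {n : ℕ} (φ : MvPolynomial (Fin n) ℝ) :
    MvPolynomial.constantCoeff (truncPoly k φ) = 0 := by
  classical
  rw [truncPoly, map_sum]
  refine Finset.sum_eq_zero fun d hd => ?_
  simp only [Finset.mem_filter] at hd
  have hd0 : d ≠ 0 := by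
    intro h
    rw [h] at hd
    simp [Finsupp.sum_zero_index] at hd
  simp [MvPolynomial.constantCoeff_monomial, hd0]

/-- Build a jet from an arbitrary tuple of polynomials by truncation. -/
noncomputable def truncJet (k n p : ℕ) (q : Fin p → MvPolynomial (Fin n) ℝ) :
    JetSpace k n p :=
  ⟨fun j => truncPoly k (q j), fun j =>
    ⟨truncPoly_totalDegree_le k (q j), truncPoly_constantCoeff k (q j)⟩⟩

/-- Precomposition of a jet with the linear map `x ↦ A x`, `A : Matrix (Fin m) (Fin m') ℝ`
(substituting the `i`-th variable by the linear form `∑ i', A i i' • X i'`). -/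
noncomputable def jetPrecomp {k m p : ℕ} {m' : ℕ} (A : Matrix (Fin m) (Fin m') ℝ)
    (z : JetSpace k m p) : JetSpace k m' p :=
  truncJet k m' p fun j =>
    MvPolynomial.aeval (fun i : Fin m => ∑ i', MvPolynomial.C (A i i') * MvPolynomial.X i')
      (z.1 j)

/-- Postcomposition of a jet with the linear map given by `B : Matrix (Fin q) (Fin p) ℝ`. -/
noncomputable def jetPostcomp {k m p q : ℕ} (B : Matrix (Fin q) (Fin p) ℝ)
    (z : JetSpace k m p) : JetSpace k m q :=
  truncJet k m q fun j => ∑ j', MvPolynomial.C (B j j') * z.1 j'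

/-! ### The stabilization `i₊` -/

/-- The map `i_{+1} : J^k(n,p) → J^k(n+1,p+1)`, `j^k₀ f ↦ j^k₀ (f × id_ℝ)`. -/
noncomputable def iPlusOne {k n p : ℕ} (hk : 1 ≤ k) (z : JetSpace k n p) :
    JetSpace k (n + 1) (p + 1) :=
  ⟨Fin.snoc (fun j => MvPolynomial.rename Fin.castSucc (z.1 j))
      (MvPolynomial.X (Fin.last n)), by
    intro j
    refine Fin.lastCases ?_ (fun j => ?_) j
    · constructor
      · simpa [Fin.snoc_last] using hk
      · simp [Fin.snoc_last]
    · simp only [Fin.snoc_castSucc]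
      exact ⟨le_trans (MvPolynomial.totalDegree_rename_le _ _) (z.2 j).1, by
        simp [MvPolynomial.constantCoeff_rename, (z.2 j).2]⟩⟩

/-- The iterated stabilization `i_{+m} : J^k(n,p) → J^k(n+m,p+m)`. -/
noncomputable def iPlus {k n p : ℕ} (hk : 1 ≤ k) :
    (m : ℕ) → JetSpace k n p → JetSpace k (n + m) (p + m)
  | 0 => id
  | m + 1 => fun z => iPlusOne hk (iPlus hk m z)


/-- `Ω_𝒦(n+m,p+m)` : the union of all `𝒦`-orbits `𝒦(i_{+m}(z))` for `z ∈ Ω(n,p)`. -/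
def OmegaK {k n p : ℕ} (hk : 1 ≤ k) (Ω : Set (JetSpace k n p)) (m : ℕ) :
    Set (JetSpace k (n + m) (p + m)) :=
  {w | ∃ z ∈ Ω, KEquiv (iPlus hk m z) w}

/-- The linear part (first differential at the origin) of a jet. -/
noncomputable def jetLinearPart {k m q : ℕ} (z : JetSpace k m q) :
    Matrix (Fin q) (Fin m) ℝ :=
  Matrix.of fun j i => MvPolynomial.coeff (Finsupp.single i 1) (z.1 j)

/-- `Σ^i(m,q)` : the jets whose linear part has kernel of dimension exactly `i`. -/
def SigmaI {k : ℕ} (m q i : ℕ) : Set (JetSpace k m q) :=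
  {z | Module.finrank ℝ (LinearMap.ker (jetLinearPart z).mulVecLin) = i}

/-! ### Helper lemmas -/

/-- All coefficients of degree at most `k` vanish. -/
def Van (k : ℕ) {ι : Type} (p : MvPolynomial ι ℝ) : Prop :=
  ∀ d : ι →₀ ℕ, d.degree ≤ k → MvPolynomial.coeff d p = 0

theorem Van.mul_const {k : ℕ} {ι : Type} {p q : MvPolynomial ι ℝ} (hp : Van k p)
    (hq : MvPolynomial.constantCoeff q = 0) : Van (k + 1) (p * q) := by
  classical
  intro d hd
  rw [MvPolynomial.coeff_mul]
  refine Finset.sum_eq_zero fun x hx => ?_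
  rw [Finset.HasAntidiagonal.mem_antidiagonal] at hx
  by_cases h : x.1.degree ≤ k
  · rw [hp _ h, zero_mul]
  · have h2 : x.1.degree + x.2.degree = d.degree := by rw [← hx, map_add]
    have h3 : x.2.degree = 0 := by omega
    rw [Finsupp.degree_eq_zero_iff] at h3
    rw [h3]
    rw [MvPolynomial.constantCoeff_eq] at hq
    rw [hq, mul_zero]

theorem Van.rename {k : ℕ} {ι κ : Type} {p : MvPolynomial ι ℝ} (hp : Van k p) (f : ι → κ) :
    Van k (MvPolynomial.rename f p) := by
  intro d hd
  refine MvPolynomial.coeff_rename_eq_zero _ _ _ fun u hu => hp u ?_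
  rw [← hu, Finsupp.degree_mapDomain] at hd
  exact hd

theorem Van.isLittleO {k n : ℕ} {p : MvPolynomial (Fin n) ℝ} (hp : Van k p) :
    (fun x => MvPolynomial.eval x p) =o[𝓝 (0 : Fin n → ℝ)] fun x => ‖x‖ ^ k := by
  simp_rw [MvPolynomial.eval_eq']
  refine IsLittleO.fun_sum fun d hd => ?_
  have hk : k < d.degree := by
    by_contra h
    exact (MvPolynomial.mem_support_iff.1 hd) (hp d (not_lt.1 h))
  refine IsLittleO.const_mul_left ?_ _
  refine IsBigO.trans_isLittleO ?_ (isLittleO_norm_pow_norm_pow (E' := Fin n → ℝ) hk)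
  refine IsBigO.of_bound 1 (Eventually.of_forall fun x => ?_)
  rw [one_mul, norm_prod, norm_pow, norm_norm, Finsupp.degree_eq_sum, ← Finset.prod_pow_eq_pow_sum]
  refine Finset.prod_le_prod (fun _ _ => norm_nonneg _) fun i _ => ?_
  rw [norm_pow]
  exact pow_le_pow_left₀ (norm_nonneg _) (norm_le_pi_norm x i) _

theorem coeff_truncPoly (k : ℕ) {n : ℕ} (φ : MvPolynomial (Fin n) ℝ) (d : Fin n →₀ ℕ)
    (h1 : 1 ≤ d.degree) (h2 : d.degree ≤ k) :
    MvPolynomial.coeff d (truncPoly k φ) = MvPolynomial.coeff d φ := by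
  classical
  rw [truncPoly, MvPolynomial.coeff_sum]
  simp only [MvPolynomial.coeff_monomial]
  rw [Finset.sum_ite_eq']
  split_ifs with h
  · rfl
  · by_contra h3
    apply h
    rw [Finset.mem_filter, MvPolynomial.mem_support_iff]
    exact ⟨fun h4 => h3 h4.symm, h1, h2⟩

theorem van_sub_truncPoly (k : ℕ) {n : ℕ} (φ : MvPolynomial (Fin n) ℝ)
    (h0 : MvPolynomial.constantCoeff φ = 0) : Van k (φ - truncPoly k φ) := by
  intro d hd
  rw [MvPolynomial.coeff_sub]
  by_cases h : d = 0
  · have := truncPoly_constantCoeff k φ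
    rw [MvPolynomial.constantCoeff_eq] at this h0
    rw [h, this, h0, sub_zero]
  · rw [coeff_truncPoly k φ d _ hd, sub_self]
    have : d.degree ≠ 0 := fun h' => h ((Finsupp.degree_eq_zero_iff d).1 h')
    omega

theorem lin_mul {ι : Type} (p q : MvPolynomial ι ℝ) (hp : MvPolynomial.constantCoeff p = 0) (a : ι) :
    MvPolynomial.coeff (Finsupp.single a 1) (p * q) =
      MvPolynomial.coeff (Finsupp.single a 1) p * MvPolynomial.constantCoeff q := by
  classical
  rw [MvPolynomial.constantCoeff_eq] at hp ⊢
  rw [MvPolynomial.coeff_mul, Finsupp.antidiagonal_single]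
  simp [Finset.Nat.antidiagonal_succ, hp]

/-- substitution of `s` for the `i0`-th variable -/
noncomputable def subst {n : ℕ} (i0 : Fin (n + 1)) (s : MvPolynomial (Fin n) ℝ) :
    MvPolynomial (Fin (n + 1)) ℝ →ₐ[ℝ] MvPolynomial (Fin n) ℝ :=
  MvPolynomial.aeval (i0.insertNth (α := fun _ => MvPolynomial (Fin n) ℝ) s MvPolynomial.X)

theorem subst_same {n : ℕ} (i0 : Fin (n + 1)) (s : MvPolynomial (Fin n) ℝ) :
    subst i0 s (MvPolynomial.X i0) = s := by simp [subst]

theorem subst_succAbove {n : ℕ} (i0 : Fin (n + 1)) (s : MvPolynomial (Fin n) ℝ) (a : Fin n) :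
    subst i0 s (MvPolynomial.X (i0.succAbove a)) = MvPolynomial.X a := by simp [subst]

theorem subst_rename {n : ℕ} (i0 : Fin (n + 1)) (s q : MvPolynomial (Fin n) ℝ) :
    subst i0 s (MvPolynomial.rename i0.succAbove q) = q := by
  have : (subst i0 s).comp (MvPolynomial.rename i0.succAbove) = AlgHom.id ℝ _ := by
    apply MvPolynomial.algHom_ext
    intro a
    simp [subst_succAbove]
  exact DFunLike.congr_fun this q

theorem constantCoeff_subst {n : ℕ} (i0 : Fin (n + 1)) (s : MvPolynomial (Fin n) ℝ)
    (hs : MvPolynomial.constantCoeff s = 0) (F : MvPolynomial (Fin (n + 1)) ℝ) :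
    MvPolynomial.constantCoeff (subst i0 s F) = MvPolynomial.constantCoeff F := by
  have : (MvPolynomial.constantCoeff).comp (subst i0 s).toRingHom =
      (MvPolynomial.constantCoeff : MvPolynomial (Fin (n + 1)) ℝ →+* ℝ) := by
    apply MvPolynomial.ringHom_ext
    · intro r
      simp [subst]
    · intro a
      refine Fin.succAboveCases i0 ?_ (fun b => ?_) a
      · simp [subst, hs]
      · simp [subst]
  exact DFunLike.congr_fun this F

theorem exists_div {n : ℕ} (i0 : Fin (n + 1)) (s : MvPolynomial (Fin n) ℝ)
    (F : MvPolynomial (Fin (n + 1)) ℝ) :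
    ∃ Q, F = MvPolynomial.rename i0.succAbove (subst i0 s F) +
      (MvPolynomial.X i0 - MvPolynomial.rename i0.succAbove s) * Q := by
  set J := Ideal.span {(MvPolynomial.X i0 - MvPolynomial.rename i0.succAbove s :
    MvPolynomial (Fin (n + 1)) ℝ)} with hJ
  have : (Ideal.Quotient.mkₐ ℝ J).comp ((MvPolynomial.rename i0.succAbove).comp (subst i0 s)) =
      Ideal.Quotient.mkₐ ℝ J := by
    apply MvPolynomial.algHom_ext
    intro a
    refine Fin.succAboveCases i0 ?_ (fun b => ?_) a
    · simp only [AlgHom.comp_apply, subst_same, Ideal.Quotient.mkₐ_eq_mk]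
      rw [eq_comm, Ideal.Quotient.eq]
      exact Ideal.subset_span rfl
    · simp [subst_succAbove]
  have h2 := DFunLike.congr_fun this F
  simp only [AlgHom.comp_apply, Ideal.Quotient.mkₐ_eq_mk] at h2
  rw [eq_comm, Ideal.Quotient.eq, hJ, Ideal.mem_span_singleton] at h2
  obtain ⟨Q, hQ⟩ := h2
  exact ⟨Q, by rw [← hQ]; ring⟩

theorem lin_rename_same {n : ℕ} (i0 : Fin (n + 1)) (q : MvPolynomial (Fin n) ℝ) :
    MvPolynomial.coeff (Finsupp.single i0 1) (MvPolynomial.rename i0.succAbove q) = 0 := by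
  refine MvPolynomial.coeff_rename_eq_zero _ _ _ fun u hu => ?_
  exfalso
  have h := DFunLike.congr_fun hu i0
  rw [Finsupp.mapDomain_notin_range] at h
  · simp at h
  · rintro ⟨b, hb⟩
    exact Fin.succAbove_ne i0 b hb

theorem lin_rename_succAbove {n : ℕ} (i0 : Fin (n + 1)) (q : MvPolynomial (Fin n) ℝ) (a : Fin n) :
    MvPolynomial.coeff (Finsupp.single (i0.succAbove a) 1) (MvPolynomial.rename i0.succAbove q) =
      MvPolynomial.coeff (Finsupp.single a 1) q := by
  rw [← MvPolynomial.coeff_rename_mapDomain i0.succAbove Fin.succAbove_right_injective q,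
    Finsupp.mapDomain_single]

theorem lin_div {n : ℕ} (i0 : Fin (n + 1)) (s : MvPolynomial (Fin n) ℝ)
    (hs : MvPolynomial.constantCoeff s = 0)
    (F Q : MvPolynomial (Fin (n + 1)) ℝ) (q : MvPolynomial (Fin n) ℝ)
    (h : F = MvPolynomial.rename i0.succAbove q +
      (MvPolynomial.X i0 - MvPolynomial.rename i0.succAbove s) * Q) :
    MvPolynomial.coeff (Finsupp.single i0 1) F = MvPolynomial.constantCoeff Q ∧
    ∀ a, MvPolynomial.coeff (Finsupp.single (i0.succAbove a) 1) F =
      MvPolynomial.coeff (Finsupp.single a 1) q -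
        MvPolynomial.coeff (Finsupp.single a 1) s * MvPolynomial.constantCoeff Q := by
  classical
  have h0 : MvPolynomial.constantCoeff
      (MvPolynomial.X i0 - MvPolynomial.rename i0.succAbove s : MvPolynomial (Fin (n + 1)) ℝ)
      = 0 := by
    simp [MvPolynomial.constantCoeff_rename, hs]
  constructor
  · rw [h, MvPolynomial.coeff_add, lin_mul _ _ h0, MvPolynomial.coeff_sub, lin_rename_same,
      lin_rename_same]
    simp
  · intro a
    rw [h, MvPolynomial.coeff_add, lin_mul _ _ h0, MvPolynomial.coeff_sub, lin_rename_succAbove,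
      lin_rename_succAbove, MvPolynomial.coeff_X', if_neg]
    · ring
    · intro h'
      have := Finsupp.single_left_injective (one_ne_zero) h'
      exact Fin.succAbove_ne i0 a this.symm

theorem exists_implicit {n : ℕ} (i0 : Fin (n + 1)) (F : MvPolynomial (Fin (n + 1)) ℝ)
    (hF : MvPolynomial.constantCoeff F = 0)
    (hc : MvPolynomial.coeff (Finsupp.single i0 1) F ≠ 0) (k : ℕ) :
    ∃ s : MvPolynomial (Fin n) ℝ, MvPolynomial.constantCoeff s = 0 ∧ Van k (subst i0 s F) := by
  induction k with
  | zero =>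
    refine ⟨0, map_zero _, fun d hd => ?_⟩
    have : d = 0 := (Finsupp.degree_eq_zero_iff d).1 (Nat.le_zero.1 hd)
    rw [this, ← MvPolynomial.constantCoeff_eq, constantCoeff_subst _ _ (map_zero _), hF]
  | succ k ih =>
    obtain ⟨s, hs, hV⟩ := ih
    obtain ⟨Q, hQ⟩ := exists_div i0 s F
    set c := MvPolynomial.coeff (Finsupp.single i0 1) F with hcdef
    have hc' : c = MvPolynomial.constantCoeff Q := (lin_div i0 s hs F Q _ hQ).1
    set s' := s - MvPolynomial.C c⁻¹ * subst i0 s F with hs'def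
    have hs' : MvPolynomial.constantCoeff s' = 0 := by
      rw [hs'def, map_sub, map_mul, constantCoeff_subst _ _ hs, hF, hs]; simp
    refine ⟨s', hs', ?_⟩
    have key : subst i0 s' F = subst i0 s F * (1 - MvPolynomial.C c⁻¹ * subst i0 s' Q) := by
      conv_lhs => rw [hQ]
      rw [map_add, map_mul, map_sub, subst_rename, subst_rename, subst_same, hs'def]
      ring
    rw [key]
    apply hV.mul_const
    rw [map_sub, map_mul, constantCoeff_subst _ _ hs', ← hc']
    simp [hc]

theorem contDiff_eval {n : ℕ} (p : MvPolynomial (Fin n) ℝ) :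
    ContDiff ℝ (⊤ : ℕ∞) (fun x : Fin n → ℝ => MvPolynomial.eval x p) := by
  simp_rw [MvPolynomial.eval_eq']
  fun_prop

theorem finrank_ker_eq {n p : ℕ} (i0 : Fin (n + 1)) (j0 : Fin (p + 1))
    (A : Matrix (Fin (p + 1)) (Fin (n + 1)) ℝ) (B : Matrix (Fin p) (Fin n) ℝ)
    (ds : Fin n → ℝ) (c : Fin (p + 1) → ℝ) (hc : c j0 ≠ 0)
    (h1 : ∀ j, A j i0 = c j) (h2 : ∀ a, A j0 (i0.succAbove a) = - (ds a * c j0))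
    (h3 : ∀ b a, A (j0.succAbove b) (i0.succAbove a) = B b a - ds a * c (j0.succAbove b)) :
    Module.finrank ℝ (LinearMap.ker B.mulVecLin) = Module.finrank ℝ (LinearMap.ker A.mulVecLin) := by
  have e0 : ∀ v : Fin (n + 1) → ℝ, A.mulVec v j0 =
      c j0 * (v i0 - ∑ a, ds a * v (i0.succAbove a)) := by
    intro v
    rw [Matrix.mulVec, dotProduct, Fin.sum_univ_succAbove _ i0, h1, mul_sub, Finset.mul_sum,
      sub_eq_add_neg, ← Finset.sum_neg_distrib]
    congr 1
    refine Finset.sum_congr rfl fun a _ => ?_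
    rw [h2]; ring
  have e1 : ∀ (v : Fin (n + 1) → ℝ) b, A.mulVec v (j0.succAbove b) =
      B.mulVec (fun a => v (i0.succAbove a)) b +
      c (j0.succAbove b) * (v i0 - ∑ a, ds a * v (i0.succAbove a)) := by
    intro v b
    rw [Matrix.mulVec, dotProduct, Fin.sum_univ_succAbove _ i0, h1, mul_sub, Finset.mul_sum,
      Matrix.mulVec, dotProduct, add_sub, add_comm, add_sub_right_comm, ← Finset.sum_sub_distrib]
    congr 1
    refine Finset.sum_congr rfl fun a _ => ?_
    rw [h3]; ring
  let L : (Fin n → ℝ) →ₗ[ℝ] (Fin (n + 1) → ℝ) :=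
    { toFun := fun v => i0.insertNth (α := fun _ => ℝ) (∑ a, ds a * v a) v
      map_add' := by
        intro u v
        ext a
        refine Fin.succAboveCases i0 ?_ (fun b => ?_) a
        · simp [mul_add, Finset.sum_add_distrib]
        · simp
      map_smul' := by
        intro r v
        ext a
        refine Fin.succAboveCases i0 ?_ (fun b => ?_) a
        · simp [Finset.mul_sum, mul_left_comm]
        · simp }
  have L0 : ∀ v, L v i0 = ∑ a, ds a * v a := fun v =>
    Fin.insertNth_apply_same (α := fun _ => ℝ) i0 _ _
  have L1 : ∀ v a, L v (i0.succAbove a) = v a := fun v a =>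
    Fin.insertNth_apply_succAbove (α := fun _ => ℝ) i0 _ _ _
  have hL : Function.Injective L := by
    intro u v huv
    ext a
    rw [← L1 u, huv, L1]
  have hmap : LinearMap.ker A.mulVecLin = (LinearMap.ker B.mulVecLin).map L := by
    ext v
    simp only [Submodule.mem_map, LinearMap.mem_ker, Matrix.mulVecLin_apply]
    constructor
    · intro hv
      have hz : v i0 - ∑ a, ds a * v (i0.succAbove a) = 0 := by
        have := e0 v
        rw [hv] at this
        simpa [hc] using this.symm
      refine ⟨fun a => v (i0.succAbove a), ?_, ?_⟩
      · ext b
        have := e1 v b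
        rw [hv, hz] at this
        simpa using this.symm
      · ext a
        refine Fin.succAboveCases i0 ?_ (fun b => ?_) a
        · rw [L0]; linarith
        · rw [L1]
    · rintro ⟨u, hu, rfl⟩
      ext j
      refine Fin.succAboveCases j0 ?_ (fun b => ?_) j
      · rw [e0]; simp [L0, L1]
      · rw [e1]; simp [L0, L1, hu]
  rw [hmap]
  exact (Submodule.equivMapOfInjective L hL _).finrank_eq

theorem diffeo_h {n : ℕ} (i0 : Fin (n + 1)) (s : MvPolynomial (Fin n) ℝ)
    (hs : MvPolynomial.constantCoeff s = 0) :
    DiffeoGermAtZero (fun x : Fin (n + 1) → ℝ => (Fin.snoc (α := fun _ => ℝ)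
      (fun a : Fin n => x (i0.succAbove a))
      (x i0 - MvPolynomial.eval (fun a => x (i0.succAbove a)) s) : Fin (n + 1) → ℝ)) := by
  set h := (fun x : Fin (n + 1) → ℝ => (Fin.snoc (α := fun _ => ℝ)
      (fun a : Fin n => x (i0.succAbove a))
      (x i0 - MvPolynomial.eval (fun a => x (i0.succAbove a)) s) : Fin (n + 1) → ℝ)) with hh
  have s0 : MvPolynomial.eval (0 : Fin n → ℝ) s = 0 := by
    rw [MvPolynomial.eval_zero]; exact hs
  have hsm : ContDiff ℝ (⊤ : ℕ∞) h := by
    rw [contDiff_pi]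
    intro a
    refine Fin.lastCases ?_ (fun b => ?_) a
    · simp only [hh, Fin.snoc_last]
      exact (contDiff_apply ℝ ℝ i0).sub ((contDiff_eval s).comp (by fun_prop))
    · simp only [hh, Fin.snoc_castSucc]
      fun_prop
  let g := fun y : Fin (n + 1) → ℝ => (i0.insertNth (α := fun _ => ℝ)
      (y (Fin.last n) + MvPolynomial.eval (fun a : Fin n => y a.castSucc) s)
      (fun a : Fin n => y a.castSucc) : Fin (n + 1) → ℝ)
  have gsm : ContDiff ℝ (⊤ : ℕ∞) g := by
    rw [contDiff_pi]
    intro a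
    refine Fin.succAboveCases i0 ?_ (fun b => ?_) a
    · simp only [g, Fin.insertNth_apply_same]
      exact (contDiff_apply ℝ ℝ (Fin.last n)).add ((contDiff_eval s).comp (by fun_prop))
    · simp only [g, Fin.insertNth_apply_succAbove]
      fun_prop
  have gh : g ∘ h = id := by
    funext x
    ext a
    refine Fin.succAboveCases i0 ?_ (fun b => ?_) a
    · simp [g, hh]
    · simp [g, hh]
  refine ⟨?_, ⟨Set.univ, univ_mem, hsm.contDiffOn⟩, ?_⟩
  · ext a
    refine Fin.lastCases ?_ (fun b => ?_) a
    · simp only [hh, Fin.snoc_last]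
      have : (fun a : Fin n => (0 : Fin (n + 1) → ℝ) (i0.succAbove a)) = 0 := rfl
      rw [this, s0]; simp
    · simp [hh]
  · have hd : DifferentiableAt ℝ h 0 := hsm.differentiable (by simp) 0
    have gd : DifferentiableAt ℝ g (h 0) := gsm.differentiable (by simp) _
    have hcomp := fderiv_comp (0 : Fin (n + 1) → ℝ) gd hd
    rw [gh, fderiv_id] at hcomp
    have inj : Function.Injective (fderiv ℝ h 0) := by
      intro u v huv
      have hu := DFunLike.congr_fun hcomp u
      have hv := DFunLike.congr_fun hcomp v
      simp only [ContinuousLinearMap.comp_apply, ContinuousLinearMap.id_apply] at hu hv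
      rw [hu, hv, huv]
    exact ⟨inj, (LinearMap.injective_iff_surjective
      (f := ((fderiv ℝ h 0 : (Fin (n + 1) → ℝ) →L[ℝ] (Fin (n + 1) → ℝ)) :
        (Fin (n + 1) → ℝ) →ₗ[ℝ] (Fin (n + 1) → ℝ)))).1 inj⟩

/-! ### Statement: Lemma 5.1 -/

/-- **Lemma 5.1** (Ando). Let `0 ≤ i < n+1`.  Every `k`-jet
`w ∈ Σ^i(n+1,p+1)` admits a `k`-jet `z ∈ Σ^i(n,p)` such that `w` lies in the
`𝒦`-orbit `𝒦(i_{+1}(z))`. -/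
theorem lemma_5_1 (k n p i : ℕ) (hk : 1 ≤ k) (hi : i < n + 1)
    (w : JetSpace k (n + 1) (p + 1)) (hw : w ∈ SigmaI (n + 1) (p + 1) i) :
    ∃ z : JetSpace k n p, z ∈ SigmaI n p i ∧ w ∈ KOrbit (iPlusOne hk z) := by
  obtain ⟨j0, i0, hne⟩ : ∃ j0 i0, jetLinearPart w j0 i0 ≠ 0 := by
    by_contra hcon
    push Not at hcon
    have h0 : jetLinearPart w = 0 := by
      ext a b; exact hcon a b
    have h1 : Module.finrank ℝ (LinearMap.ker (jetLinearPart w).mulVecLin) = i := hw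
    rw [h0, Matrix.mulVecLin_zero, LinearMap.ker_zero, finrank_top] at h1
    simp at h1
    omega
  have hne' : MvPolynomial.coeff (Finsupp.single i0 1) (w.1 j0) ≠ 0 := hne
  obtain ⟨s, hs, hV⟩ := exists_implicit i0 (w.1 j0) (w.2 j0).2 hne' k
  choose Q hQ using fun j => exists_div i0 s (w.1 j)
  have hlin := fun j => lin_div i0 s hs (w.1 j) (Q j) _ (hQ j)
  have hQ0 : MvPolynomial.constantCoeff (Q j0) ≠ 0 := by rw [← (hlin j0).1]; exact hne'
  let z : JetSpace k n p := truncJet k n p fun b => subst i0 s (w.1 (j0.succAbove b))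
  refine ⟨z, ?_, ?_⟩
  · have hw' : Module.finrank ℝ (LinearMap.ker (jetLinearPart w).mulVecLin) = i := hw
    change Module.finrank ℝ (LinearMap.ker (jetLinearPart z).mulVecLin) = i
    rw [← hw']
    refine finrank_ker_eq i0 j0 _ _ (fun a => MvPolynomial.coeff (Finsupp.single a 1) s)
      (fun j => MvPolynomial.constantCoeff (Q j)) hQ0 (fun j => (hlin j).1) ?_ ?_
    · intro a
      have h := (hlin j0).2 a
      rw [hV _ (by simpa using hk), zero_sub] at h
      exact h
    · intro b a
      have h := (hlin (j0.succAbove b)).2 a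
      rw [← coeff_truncPoly k (subst i0 s _) _ (by simp) (by simpa using hk)] at h
      exact h
  · let h := (fun x : Fin (n + 1) → ℝ => (Fin.snoc (α := fun _ => ℝ)
      (fun a : Fin n => x (i0.succAbove a))
      (x i0 - MvPolynomial.eval (fun a => x (i0.succAbove a)) s) : Fin (n + 1) → ℝ))
    let M : (Fin (n + 1) → ℝ) → Matrix (Fin (p + 1)) (Fin (p + 1)) ℝ := fun x => Matrix.of fun j =>
      Fin.snoc (α := fun _ => ℝ) (fun b : Fin p => if j = j0.succAbove b then (1 : ℝ) else 0)
        (MvPolynomial.eval x (Q j))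
    have hM : ∀ x v j, (M x).mulVec v j =
        (∑ b : Fin p, (if j = j0.succAbove b then (1 : ℝ) else 0) * v b.castSucc) +
          MvPolynomial.eval x (Q j) * v (Fin.last p) := by
      intro x v j
      rw [Matrix.mulVec, dotProduct, Fin.sum_univ_castSucc]
      simp [M]
    have hM0 : ∀ x v, (M x).mulVec v j0 = MvPolynomial.eval x (Q j0) * v (Fin.last p) := by
      intro x v
      rw [hM, Finset.sum_eq_zero, zero_add]
      intro b _
      rw [if_neg (Fin.succAbove_ne j0 b).symm, zero_mul]
    have hM1 : ∀ x v b, (M x).mulVec v (j0.succAbove b) =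
        v b.castSucc + MvPolynomial.eval x (Q (j0.succAbove b)) * v (Fin.last p) := by
      intro x v b
      rw [hM]
      simp [Fin.succAbove_right_inj]
    have hMs : ContDiff ℝ (⊤ : ℕ∞)
        (fun x (i : Fin (p + 1)) (j : Fin (p + 1)) => M x i j) := by
      rw [contDiff_pi]
      intro a
      rw [contDiff_pi]
      intro b
      refine Fin.lastCases ?_ (fun b => ?_) b
      · simp only [M, Matrix.of_apply, Fin.snoc_last]
        exact contDiff_eval _
      · simp only [M, Matrix.of_apply, Fin.snoc_castSucc]
        exact contDiff_const
    have hh : DiffeoGermAtZero h := diffeo_h i0 s hs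
    have hf : ContDiff ℝ (⊤ : ℕ∞) (iPlusOne hk z).eval := by
      rw [contDiff_pi]
      intro a
      exact contDiff_eval _
    have hf0 : (iPlusOne hk z).eval 0 = 0 := by
      ext j
      change MvPolynomial.eval 0 _ = 0
      rw [MvPolynomial.eval_zero]
      exact ((iPlusOne hk z).2 j).2
    have fl : ∀ x, (iPlusOne hk z).eval (h x) (Fin.last p) =
        x i0 - MvPolynomial.eval (fun a => x (i0.succAbove a)) s := by
      intro x
      simp [JetSpace.eval, iPlusOne, h]
    have fc : ∀ x b, (iPlusOne hk z).eval (h x) b.castSucc =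
        MvPolynomial.eval (fun a => x (i0.succAbove a)) (z.1 b) := by
      intro x b
      simp only [JetSpace.eval, iPlusOne, h, Fin.snoc_castSucc, MvPolynomial.eval_rename]
      congr 2
      funext a
      simp
    have hev : ∀ (x : Fin (n + 1) → ℝ) (q : MvPolynomial (Fin n) ℝ),
        MvPolynomial.eval (fun a => x (i0.succAbove a)) q =
          MvPolynomial.eval x (MvPolynomial.rename i0.succAbove q) := by
      intro x q
      rw [MvPolynomial.eval_rename]; rfl
    have hwe : ∀ x j, w.eval x j = MvPolynomial.eval x (MvPolynomial.rename i0.succAbove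
        (subst i0 s (w.1 j))) +
        (x i0 - MvPolynomial.eval x (MvPolynomial.rename i0.succAbove s)) *
          MvPolynomial.eval x (Q j) := by
      intro x j
      have := congrArg (MvPolynomial.eval x) (hQ j)
      simpa [JetSpace.eval] using this
    refine ⟨(iPlusOne hk z).eval, fun x => (M x).mulVec ((iPlusOne hk z).eval (h x)),
      ⟨Set.univ, univ_mem, hf.contDiffOn⟩, ?_, hf0, ?_, ?_, ?_, h, M, hh,
      ⟨Set.univ, univ_mem, hMs.contDiffOn⟩, ?_, Eventually.of_forall fun x => rfl⟩
    · obtain ⟨U, hU, hUs⟩ := hh.2.1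
      refine ⟨U, hU, ?_⟩
      rw [contDiffOn_pi]
      intro j
      simp only [Matrix.mulVec, dotProduct]
      refine ContDiffOn.sum fun b _ => ?_
      refine ContDiffOn.mul ?_ ?_
      · have := contDiff_pi.1 (contDiff_pi.1 hMs j) b
        exact this.contDiffOn
      · exact (contDiff_pi.1 hf b).comp_contDiffOn hUs
    · simp only [hh.1, hf0, Matrix.mulVec_zero]
    · simp [IsJetAt, isLittleO_zero]
    · rw [IsJetAt, isLittleO_pi]
      intro j
      refine Fin.succAboveCases j0 ?_ (fun b => ?_) j
      · refine (hV.rename i0.succAbove).isLittleO.neg_left.congr_left fun x => ?_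
        rw [Pi.sub_apply, hM0, fl, hwe, hev]
        ring
      · refine ((van_sub_truncPoly k (subst i0 s (w.1 (j0.succAbove b))) ?_).rename
          i0.succAbove).isLittleO.neg_left.congr_left fun x => ?_
        · rw [constantCoeff_subst _ _ hs]; exact (w.2 _).2
        · rw [Pi.sub_apply, hM1, fl, fc, hwe, hev, hev, map_sub, map_sub]
          change _ = MvPolynomial.eval x (MvPolynomial.rename i0.succAbove (truncPoly k _)) + _ - _
          ring
    · rw [← Matrix.mulVec_injective_iff_isUnit]
      have hQe : MvPolynomial.eval 0 (Q j0) ≠ 0 := by rw [MvPolynomial.eval_zero]; exact hQ0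
      intro u v huv
      have hl : u (Fin.last p) = v (Fin.last p) := by
        have := congrFun huv j0
        rw [hM0, hM0] at this
        exact mul_left_cancel₀ hQe this
      ext j
      refine Fin.lastCases hl (fun b => ?_) j
      have := congrFun huv (j0.succAbove b)
      rw [hM1, hM1, hl] at this
      exact add_right_cancel this

end AndoCob
end

section
/- Let Ω(n,p) be a K-invariant open subset of J^k(n,p) and let m > 0. Then the set Ω_K(n+m,p+m), consisting of all K-orbits K(i_{+m}(z)) for k-jets z ∈ Ω(n,p), is open in J^k(n+m,p+m). -/
open scoped Topology unitInterval
open Filter Asymptotics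
open scoped Manifold

namespace AndoCob


theorem exists_radial {N : ℕ} (q : MvPolynomial (Fin N) ℝ) :
    ∃ r : MvPolynomial (Fin N) ℝ, r.totalDegree ≤ q.totalDegree ∧
      ∀ (x : Fin N → ℝ) (t : ℝ), HasDerivAt (fun t : ℝ => t * MvPolynomial.eval (t • x) r)
        (MvPolynomial.eval (t • x) q) t := by
  classical
  refine ⟨∑ d ∈ q.support, MvPolynomial.monomial d
    (MvPolynomial.coeff d q / ((d.sum fun _ e => e : ℕ) + 1)), ?_, ?_⟩
  · refine le_trans (MvPolynomial.totalDegree_finsetSum _ _) ?_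
    refine Finset.sup_le fun d hd => ?_
    exact le_trans (MvPolynomial.totalDegree_monomial_le _ _) (MvPolynomial.le_totalDegree hd)
  · intro x t
    have key : ∀ (d : Fin N →₀ ℕ) (c s : ℝ), MvPolynomial.eval (s • x) (MvPolynomial.monomial d c)
        = s ^ (d.sum fun _ e => e) * (c * d.prod fun i e => x i ^ e) := by
      intro d c s
      rw [MvPolynomial.eval_monomial]
      simp only [Finsupp.prod, Finsupp.sum, Pi.smul_apply, smul_eq_mul, mul_pow,
        Finset.prod_mul_distrib, Finset.prod_pow_eq_pow_sum]
      ring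
    have h2 : MvPolynomial.eval (t • x) q = ∑ d ∈ q.support,
        t ^ (d.sum fun _ e => e) * (MvPolynomial.coeff d q * d.prod fun i e => x i ^ e) := by
      conv_lhs => rw [q.as_sum, map_sum]
      exact Finset.sum_congr rfl fun d _ => key d _ t
    have h1 : (fun t : ℝ => t * MvPolynomial.eval (t • x) (∑ d ∈ q.support, MvPolynomial.monomial d
        (MvPolynomial.coeff d q / ((d.sum fun _ e => e : ℕ) + 1)))) = fun t => ∑ d ∈ q.support,
        t ^ ((d.sum fun _ e => e) + 1) * (MvPolynomial.coeff d q / ((d.sum fun _ e => e : ℕ) + 1)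
          * d.prod fun i e => x i ^ e) := by
      funext t
      rw [map_sum, Finset.mul_sum]
      refine Finset.sum_congr rfl fun d _ => ?_
      rw [key]; ring
    rw [h1, h2]
    refine HasDerivAt.fun_sum fun d _ => ?_
    have h3 := (hasDerivAt_pow ((d.sum fun _ e => e) + 1) t).mul_const
      (MvPolynomial.coeff d q / ((d.sum fun _ e => e : ℕ) + 1) * d.prod fun i e => x i ^ e)
    refine h3.congr_deriv ?_
    have : ((d.sum fun _ e => e : ℕ) : ℝ) + 1 ≠ 0 := by positivity
    simp only [Nat.add_sub_cancel, Nat.cast_add, Nat.cast_one]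
    field_simp

theorem taylor_mv (N k : ℕ) : ∀ f : (Fin N → ℝ) → ℝ,
    (∃ U ∈ 𝓝 (0 : Fin N → ℝ), ContDiffOn ℝ (⊤ : ℕ∞) f U) →
    ∃ q : MvPolynomial (Fin N) ℝ, q.totalDegree ≤ k ∧
      (fun x => f x - MvPolynomial.eval x q) =o[𝓝 (0 : Fin N → ℝ)] fun x => ‖x‖ ^ k := by
  induction k with
  | zero =>
    rintro f ⟨U, hU, hf⟩
    refine ⟨MvPolynomial.C (f 0), by simp, ?_⟩
    have hc : ContinuousAt f 0 := hf.continuousOn.continuousAt hU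
    simp only [pow_zero, MvPolynomial.eval_C]
    rw [Asymptotics.isLittleO_one_iff]
    have := hc.tendsto.sub_const (f 0)
    simpa using this
  | succ k ih =>
    rintro f ⟨U, hU, hf⟩
    obtain ⟨V, hVU, hV, h0V⟩ := mem_nhds_iff.1 hU
    have hfV := hf.mono hVU
    have hpar : ∀ i : Fin N, ContDiffOn ℝ (⊤ : ℕ∞) (fun x => fderiv ℝ f x (Pi.single i 1)) V := by
      intro i
      have := hfV.fderiv_of_isOpen (m := (⊤ : ℕ∞)) hV (by simp)
      exact this.clm_apply contDiffOn_const
    choose q hqd hq using fun i => ih _ ⟨V, hV.mem_nhds h0V, hpar i⟩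
    choose r hrd hr using fun i => exists_radial (q i)
    refine ⟨MvPolynomial.C (f 0) + ∑ i, MvPolynomial.X i * r i, ?_, ?_⟩
    · refine (MvPolynomial.totalDegree_add _ _).trans (max_le (by simp) ?_)
      refine MvPolynomial.totalDegree_finsetSum_le fun i _ => ?_
      refine (MvPolynomial.totalDegree_mul _ _).trans ?_
      have := (hrd i).trans (hqd i)
      rw [MvPolynomial.totalDegree_X]; omega
    · rw [Asymptotics.isLittleO_iff]
      intro c hc
      have hc' : 0 < c / (N + 1) := by positivity
      have hev : ∀ᶠ x in 𝓝 (0 : Fin N → ℝ), x ∈ V ∧ ∀ i,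
          ‖fderiv ℝ f x (Pi.single i 1) - MvPolynomial.eval x (q i)‖ ≤ c / (N + 1) * ‖‖x‖ ^ k‖ :=
        Filter.Eventually.and (hV.mem_nhds h0V) (eventually_all.2 fun i => (Asymptotics.isLittleO_iff.1 (hq i)) hc')
      obtain ⟨ε, hε, hball⟩ := Metric.eventually_nhds_iff_ball.1 hev
      filter_upwards [Metric.ball_mem_nhds (0 : Fin N → ℝ) hε] with x hx
      have hseg : ∀ t ∈ Set.Icc (0 : ℝ) 1, ‖t • x‖ ≤ ‖x‖ := by
        intro t ht
        rw [norm_smul, Real.norm_of_nonneg ht.1]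
        exact mul_le_of_le_one_left (norm_nonneg _) ht.2
      have hsegb : ∀ t ∈ Set.Icc (0 : ℝ) 1, t • x ∈ Metric.ball (0 : Fin N → ℝ) ε := by
        intro t ht
        rw [mem_ball_zero_iff] at hx ⊢
        exact (hseg t ht).trans_lt hx
      have hder : ∀ t ∈ Set.Icc (0 : ℝ) 1, HasDerivWithinAt
          (fun t : ℝ => f (t • x) - (f 0 + ∑ i, x i * (t * MvPolynomial.eval (t • x) (r i))))
          (∑ i, x i * (fderiv ℝ f (t • x) (Pi.single i 1) - MvPolynomial.eval (t • x) (q i)))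
          (Set.Icc 0 1) t := by
        intro t ht
        have hmem := (hball _ (hsegb t ht)).1
        have hd : HasFDerivAt f (fderiv ℝ f (t • x)) (t • x) :=
          ((hfV.differentiableOn (by simp)).differentiableAt (hV.mem_nhds hmem)).hasFDerivAt
        have h1 : HasDerivAt (fun t : ℝ => t • x) x t := by
          simpa using (hasDerivAt_id t).smul_const x
        have h2 := hd.comp_hasDerivAt t h1
        have h3 : HasDerivAt (fun t : ℝ => f 0 + ∑ i, x i * (t * MvPolynomial.eval (t • x) (r i)))
            (∑ i, x i * MvPolynomial.eval (t • x) (q i)) t :=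
          (HasDerivAt.fun_sum fun i _ => (hr i x t).const_mul (x i)).const_add _
        have h4 := (h2.sub h3).hasDerivWithinAt (s := Set.Icc 0 1)
        refine h4.congr_deriv ?_
        have h5 : fderiv ℝ f (t • x) x = ∑ i, x i * fderiv ℝ f (t • x) (Pi.single i 1) := by
          have h6 : ∀ ℓ : (Fin N → ℝ) →L[ℝ] ℝ, ℓ x = ∑ i, x i * ℓ (Pi.single i 1) := by
            intro ℓ
            conv_lhs => rw [pi_eq_sum_univ' x, map_sum]
            exact Finset.sum_congr rfl fun i _ => by rw [map_smul, smul_eq_mul]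
          exact h6 _
        rw [h5, ← Finset.sum_sub_distrib]
        exact Finset.sum_congr rfl fun i _ => by ring
      have hbd := norm_image_sub_le_of_norm_deriv_le_segment_01' hder
        (C := c * ‖x‖ ^ (k + 1)) (by
          intro t ht
          have ht' : t ∈ Set.Icc (0 : ℝ) 1 := ⟨ht.1, ht.2.le⟩
          refine (norm_sum_le _ _).trans ?_
          have : ∀ i ∈ (Finset.univ : Finset (Fin N)), ‖x i * (fderiv ℝ f (t • x) (Pi.single i 1)
              - MvPolynomial.eval (t • x) (q i))‖ ≤ ‖x‖ * (c / (N + 1) * ‖x‖ ^ k) := by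
            intro i _
            rw [norm_mul]
            refine mul_le_mul (norm_le_pi_norm x i) ?_ (norm_nonneg _) (norm_nonneg _)
            refine ((hball _ (hsegb t ht')).2 i).trans ?_
            rw [norm_pow, norm_norm]
            have := hseg t ht'
            gcongr
          refine (Finset.sum_le_sum this).trans ?_
          rw [Finset.sum_const, Finset.card_univ, Fintype.card_fin, nsmul_eq_mul]
          have h7 : (N : ℝ) * (‖x‖ * (c / (N + 1) * ‖x‖ ^ k)) = (N / (N + 1)) * (c * ‖x‖ ^ (k + 1)) := by
            ring
          rw [h7]
          refine mul_le_of_le_one_left (by positivity) ?_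
          rw [div_le_one (by positivity)]; linarith)
      simpa [MvPolynomial.eval_add] using hbd

theorem poly_littleO_zero (k : ℕ) : ∀ p : Polynomial ℝ, p.natDegree ≤ k →
    (fun t => p.eval t) =o[𝓝 (0 : ℝ)] (fun t => t ^ k) → p = 0 := by
  induction k with
  | zero =>
    intro p hd h
    rw [Polynomial.eq_C_of_natDegree_le_zero hd] at h ⊢
    simp only [pow_zero, Polynomial.eval_C, Asymptotics.isLittleO_one_iff] at h
    rw [tendsto_nhds_unique h tendsto_const_nhds |>.symm]
    simp
  | succ k ih =>
    intro p hd h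
    have h0 : p.coeff 0 = 0 := by
      have h1 := h.trans_tendsto (by
        have : Continuous fun t : ℝ => t ^ (k + 1) := by fun_prop
        simpa using this.tendsto 0)
      have h2 : Continuous fun t => p.eval t := p.continuous
      have := tendsto_nhds_unique (h2.tendsto 0) h1
      rwa [← Polynomial.coeff_zero_eq_eval_zero] at this
    obtain ⟨r, rfl⟩ := Polynomial.X_dvd_iff.2 h0
    rw [ih r ?_ ?_, mul_zero]
    · by_cases hr : r = 0
      · simp [hr]
      · rw [Polynomial.natDegree_X_mul hr] at hd; omega
    · rw [Asymptotics.isLittleO_iff] at h ⊢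
      intro c hc
      have h1 : ∀ᶠ t in 𝓝[≠] (0 : ℝ), ‖r.eval t‖ ≤ c * ‖t ^ k‖ := by
        filter_upwards [(h hc).filter_mono nhdsWithin_le_nhds, self_mem_nhdsWithin] with t ht ht0
        have : 0 < ‖t‖ := norm_pos_iff.2 ht0
        simp only [Polynomial.eval_mul, Polynomial.eval_X, norm_mul, pow_succ] at ht
        refine le_of_mul_le_mul_left ?_ this
        linarith
      have hcl : IsClosed {t : ℝ | ‖r.eval t‖ ≤ c * ‖t ^ k‖} :=
        isClosed_le (by fun_prop) (by fun_prop)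
      have h2 : ‖r.eval (0:ℝ)‖ ≤ c * ‖(0:ℝ) ^ k‖ :=
        hcl.mem_of_frequently_of_tendsto h1.frequently (tendsto_id.mono_left nhdsWithin_le_nhds)
      rw [eventually_nhdsWithin_iff] at h1
      filter_upwards [h1] with t ht
      by_cases h : t = 0
      · rw [h]; exact h2
      · exact ht h

theorem mv_littleO_zero {N k : ℕ} (q : MvPolynomial (Fin N) ℝ) (hd : q.totalDegree ≤ k)
    (h : (fun x => MvPolynomial.eval x q) =o[𝓝 (0 : Fin N → ℝ)] fun x => ‖x‖ ^ k) : q = 0 := by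
  refine MvPolynomial.funext fun x => ?_
  let P : Polynomial ℝ := MvPolynomial.aeval (fun i => Polynomial.C (x i) * Polynomial.X) q
  have hP : ∀ t, P.eval t = MvPolynomial.eval (t • x) q := by
    intro t
    have : (Polynomial.aeval t).comp (MvPolynomial.aeval (R := ℝ)
        (fun i => Polynomial.C (x i) * Polynomial.X)) =
        (MvPolynomial.aeval (t • x) : MvPolynomial (Fin N) ℝ →ₐ[ℝ] ℝ) := by
      ext i
      simp only [AlgHom.comp_apply, MvPolynomial.aeval_X, map_mul, Polynomial.aeval_C,
        Polynomial.aeval_X, Pi.smul_apply, smul_eq_mul]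
      exact mul_comm _ _
    have := DFunLike.congr_fun this q
    simpa [MvPolynomial.aeval_eq_eval, Polynomial.aeval_def] using this
  have hdeg : P.natDegree ≤ k := by
    refine le_trans ?_ hd
    have := MvPolynomial.aeval_natDegree_le (R := ℝ) q (m := q.totalDegree) le_rfl
      (fun i => Polynomial.C (x i) * Polynomial.X) (n := 1)
      (fun i => by simpa using Polynomial.natDegree_C_mul_X_pow_le (x i) 1)
    simpa using this
  have hPo : (fun t => P.eval t) =o[𝓝 (0 : ℝ)] (fun t => t ^ k) := by
    have ht : Tendsto (fun t : ℝ => t • x) (𝓝 0) (𝓝 0) := by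
      have : Continuous fun t : ℝ => t • x := by fun_prop
      simpa using this.tendsto 0
    have h1 := h.comp_tendsto ht
    have h2 : (fun t => P.eval t) = (fun x => MvPolynomial.eval x q) ∘ fun t : ℝ => t • x := by
      funext t; exact hP t
    rw [h2]
    refine h1.trans_isBigO ?_
    refine Asymptotics.IsBigO.of_bound (‖x‖ ^ k) (Eventually.of_forall fun t => ?_)
    simp [norm_smul, mul_pow, mul_comm]
  have := poly_littleO_zero k P hdeg hPo
  have h3 := hP 1
  rw [this] at h3
  simpa using h3.symm


/-! ### Coordinates on jet spaces -/

abbrev DD (k N : ℕ) : Type :=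
  {d : Fin N → Fin (k + 1) // 1 ≤ ∑ i, (d i : ℕ) ∧ ∑ i, (d i : ℕ) ≤ k}

abbrev EE (k N P : ℕ) : Type := Fin P → DD k N → ℝ

noncomputable def expo {k N : ℕ} (d : Fin N → Fin (k + 1)) : Fin N →₀ ℕ :=
  Finsupp.equivFunOnFinite.symm fun i => (d i : ℕ)

theorem expo_apply {k N : ℕ} (d : Fin N → Fin (k + 1)) (i : Fin N) : expo d i = d i := rfl

theorem expo_inj {k N : ℕ} {d e : Fin N → Fin (k + 1)} : expo d = expo e ↔ d = e := by
  constructor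
  · intro h
    funext i
    exact Fin.ext (DFunLike.congr_fun h i)
  · rintro rfl; rfl

theorem expo_sum {k N : ℕ} (d : Fin N → Fin (k + 1)) :
    ((expo d).sum fun _ e => e) = ∑ i, (d i : ℕ) := by
  rw [Finsupp.sum_fintype _ _ (fun _ => rfl)]; rfl

noncomputable def SS {k N : ℕ} (a : DD k N → ℝ) : MvPolynomial (Fin N) ℝ :=
  ∑ d, MvPolynomial.monomial (expo d.1) (a d)

theorem eval_SS {k N : ℕ} (a : DD k N → ℝ) (x : Fin N → ℝ) :
    MvPolynomial.eval x (SS a) = ∑ d, a d * ∏ i, x i ^ (d.1 i : ℕ) := by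
  rw [SS, map_sum]
  refine Finset.sum_congr rfl fun d _ => ?_
  rw [MvPolynomial.eval_monomial, Finsupp.prod_fintype _ _ (fun _ => pow_zero _)]
  rfl

theorem coeff_SS {k N : ℕ} (a : DD k N → ℝ) (e : Fin N →₀ ℕ) :
    MvPolynomial.coeff e (SS a) = ∑ d : DD k N, if expo d.1 = e then a d else 0 := by
  classical
  rw [SS, MvPolynomial.coeff_sum]
  exact Finset.sum_congr rfl fun d _ => by rw [MvPolynomial.coeff_monomial]

theorem coeff_SS' {k N : ℕ} (a : DD k N → ℝ) (e : DD k N) :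
    MvPolynomial.coeff (expo e.1) (SS a) = a e := by
  classical
  rw [coeff_SS, Finset.sum_eq_single e]
  · simp
  · intro b _ hb
    rw [if_neg]
    rw [expo_inj]
    exact fun h => hb (Subtype.ext h)
  · simp

theorem SS_totalDegree {k N : ℕ} (a : DD k N → ℝ) : (SS a).totalDegree ≤ k := by
  refine MvPolynomial.totalDegree_finsetSum_le fun d _ => ?_
  refine (MvPolynomial.totalDegree_monomial_le _ _).trans ?_
  have := expo_sum d.1
  exact this.le.trans d.2.2

theorem SS_const {k N : ℕ} (a : DD k N → ℝ) : MvPolynomial.constantCoeff (SS a) = 0 := by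
  rw [MvPolynomial.constantCoeff_eq, coeff_SS]
  refine Finset.sum_eq_zero fun d _ => ?_
  rw [if_neg]
  intro h
  have h1 := expo_sum d.1
  rw [h, Finsupp.sum_zero_index] at h1
  have := d.2.1
  omega

theorem SS_coeff {k N : ℕ} (q : MvPolynomial (Fin N) ℝ) (hd : q.totalDegree ≤ k)
    (h0 : MvPolynomial.constantCoeff q = 0) :
    SS (fun d : DD k N => MvPolynomial.coeff (expo d.1) q) = q := by
  classical
  ext c
  by_cases hc : ∃ d : DD k N, expo d.1 = c
  · obtain ⟨d, rfl⟩ := hc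
    rw [coeff_SS']
  · rw [coeff_SS, Finset.sum_eq_zero (fun d _ => if_neg fun h => hc ⟨d, h⟩)]
    by_contra hne
    have hmem : c ∈ q.support := MvPolynomial.mem_support_iff.2 (Ne.symm hne)
    have h1 := (MvPolynomial.le_totalDegree hmem).trans hd
    rw [Finsupp.sum_fintype _ _ (fun _ => rfl)] at h1
    have h2 : ∀ i, c i ≤ k := fun i =>
      (Finset.single_le_sum (f := fun i => c i) (fun _ _ => Nat.zero_le _)
        (Finset.mem_univ i)).trans h1
    refine hc ⟨⟨fun i => ⟨c i, Nat.lt_succ_of_le (h2 i)⟩, ?_, h1⟩, ?_⟩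
    · by_contra h3
      have h4 : ∑ i, c i = 0 := by
        have : ¬ (1 ≤ ∑ i, c i) := h3
        omega
      have h5 : c = 0 := by
        ext i
        exact (Finset.sum_eq_zero_iff.1 h4) i (Finset.mem_univ i)
      rw [h5, ← MvPolynomial.constantCoeff_eq, h0] at hne
      exact hne rfl
    · ext i; rfl

noncomputable def JJ {k N P : ℕ} (a : EE k N P) : JetSpace k N P :=
  ⟨fun j => SS (a j), fun j => ⟨SS_totalDegree _, SS_const _⟩⟩

noncomputable def cf {k N P : ℕ} (w : JetSpace k N P) : EE k N P :=
  fun j d => MvPolynomial.coeff (expo d.1) (w.1 j)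

theorem JJ_cf {k N P : ℕ} (w : JetSpace k N P) : JJ (cf w) = w :=
  Subtype.ext (funext fun j => SS_coeff _ (w.2 j).1 (w.2 j).2)

theorem continuous_cf {k N P : ℕ} : Continuous (cf : JetSpace k N P → EE k N P) := by
  have h : Continuous (jetCoeffs : JetSpace k N P → _) := continuous_induced_dom
  refine continuous_pi fun j => continuous_pi fun d => ?_
  exact (continuous_apply d.1).comp ((continuous_apply j).comp h)

theorem continuous_JJ {k N P : ℕ} : Continuous (JJ : EE k N P → JetSpace k N P) := by
  classical
  refine continuous_induced_rng.2 ?_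
  refine continuous_pi fun j => continuous_pi fun e => ?_
  have : (fun a : EE k N P => (jetCoeffs (JJ a)) j e) = fun a =>
      ∑ d : DD k N, if expo d.1 = expo e then a j d else 0 := by
    funext a
    exact coeff_SS (a j) (expo e)
  simp only [Function.comp_apply]
  rw [this]
  refine continuous_finsetSum _ fun d _ => ?_
  split_ifs <;> fun_prop

noncomputable def ev {k N P : ℕ} (a : EE k N P) (x : Fin N → ℝ) : Fin P → ℝ :=
  fun j => ∑ d, a j d * ∏ i, x i ^ (d.1 i : ℕ)

theorem eval_JJ {k N P : ℕ} (a : EE k N P) : (JJ a).eval = ev a := by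
  funext x j
  exact eval_SS (a j) x

theorem eval_cf {k N P : ℕ} (w : JetSpace k N P) : ev (cf w) = w.eval := by
  rw [← eval_JJ, JJ_cf]

theorem ev_zero {k N P : ℕ} (a : EE k N P) : ev a 0 = 0 := by
  funext j
  have := eval_SS (a j) 0
  rw [MvPolynomial.eval_zero, SS_const] at this
  exact this.symm

theorem ev_add {k N P : ℕ} (a b : EE k N P) : ev (a + b) = ev a + ev b := by
  funext x j
  simp [ev, add_mul, Finset.sum_add_distrib]

theorem ev_smul {k N P : ℕ} (c : ℝ) (a : EE k N P) : ev (c • a) = c • ev a := by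
  funext x j
  simp [ev, mul_assoc, Finset.mul_sum]

theorem ev_contDiff {k N P : ℕ} (a : EE k N P) : ContDiff ℝ (⊤ : ℕ∞) (ev a) := by
  unfold ev
  fun_prop

/-- `f` has jet `a`. -/
def HJ {k N P : ℕ} (f : (Fin N → ℝ) → Fin P → ℝ) (a : EE k N P) : Prop :=
  (fun x => f x - ev a x) =o[𝓝 (0 : Fin N → ℝ)] fun x => ‖x‖ ^ k

theorem HJ_iff {k N P : ℕ} {f : (Fin N → ℝ) → Fin P → ℝ} {a : EE k N P} :
    IsJetAt (JJ a) f ↔ HJ f a := by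
  rw [IsJetAt, HJ, eval_JJ]

theorem HJ_cf {k N P : ℕ} {f : (Fin N → ℝ) → Fin P → ℝ} {w : JetSpace k N P} :
    HJ f (cf w) ↔ IsJetAt w f := by
  rw [IsJetAt, HJ, eval_cf]

theorem HJ_ev {k N P : ℕ} (a : EE k N P) : HJ (ev a) a := by
  simp [HJ]

theorem HJ.add {k N P : ℕ} {f g : (Fin N → ℝ) → Fin P → ℝ} {a b : EE k N P}
    (hf : HJ f a) (hg : HJ g b) : HJ (f + g) (a + b) := by
  refine (IsLittleO.add hf hg).congr_left fun x => ?_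
  rw [ev_add]
  simp only [Pi.add_apply]
  abel

theorem HJ.smul {k N P : ℕ} {f : (Fin N → ℝ) → Fin P → ℝ} {a : EE k N P}
    (c : ℝ) (hf : HJ f a) : HJ (c • f) (c • a) := by
  refine (IsLittleO.const_smul_left hf c).congr_left fun x => ?_
  rw [ev_smul]
  simp only [Pi.smul_apply, smul_sub]

theorem ev_littleO {k N P : ℕ} {a : EE k N P}
    (h : (ev a) =o[𝓝 (0 : Fin N → ℝ)] fun x => ‖x‖ ^ k) : a = 0 := by
  funext j d
  have h1 : (fun x => MvPolynomial.eval x (SS (a j))) =o[𝓝 (0 : Fin N → ℝ)] fun x => ‖x‖ ^ k := by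
    refine ((isLittleO_pi.1 h) j).congr_left fun x => ?_
    exact (eval_SS (a j) x).symm
  have h2 := mv_littleO_zero _ (SS_totalDegree _) h1
  rw [← coeff_SS' (a j) d, h2]
  simp

theorem HJ.unique {k N P : ℕ} {f : (Fin N → ℝ) → Fin P → ℝ} {a b : EE k N P}
    (ha : HJ f a) (hb : HJ f b) : a = b := by
  have h : HJ ((f + (-1 : ℝ) • f)) (a + (-1 : ℝ) • b) := ha.add (hb.smul (-1))
  have h2 : a + (-1 : ℝ) • b = 0 := by
    refine ev_littleO ?_
    refine (IsLittleO.neg_left h).congr_left fun x => ?_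
    simp
  have : a - b = 0 := by simpa [sub_eq_add_neg] using h2
  exact sub_eq_zero.1 this

theorem exists_HJ {k N P : ℕ} {f : (Fin N → ℝ) → Fin P → ℝ} (hf : SmoothGermAtZero f)
    (h0 : f 0 = 0) : ∃ a : EE k N P, HJ f a := by
  obtain ⟨U, hU, hf⟩ := hf
  have hj : ∀ j, ∃ a : DD k N → ℝ, (fun x => f x j - MvPolynomial.eval x (SS a))
      =o[𝓝 (0 : Fin N → ℝ)] fun x => ‖x‖ ^ k := by
    intro j
    have hfj : ContDiffOn ℝ (⊤ : ℕ∞) (fun x => f x j) U := contDiffOn_pi.1 hf j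
    obtain ⟨q, hqd, hq⟩ := taylor_mv N k _ ⟨U, hU, hfj⟩
    by_cases hk : k = 0
    · refine ⟨0, ?_⟩
      subst hk
      simp only [pow_zero]
      rw [Asymptotics.isLittleO_one_iff]
      have hc : ContinuousAt (fun x => f x j) 0 := hfj.continuousOn.continuousAt hU
      have := hc.tendsto
      simp only [h0] at this
      simpa [eval_SS] using this
    · have hq0 : MvPolynomial.constantCoeff q = 0 := by
        have hc : ContinuousAt (fun x => f x j) 0 := hfj.continuousOn.continuousAt hU
        have hc2 : Continuous fun x => MvPolynomial.eval x q := MvPolynomial.continuous_eval q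
        have h1 : Tendsto (fun x => f x j - MvPolynomial.eval x q) (𝓝 (0 : Fin N → ℝ)) (𝓝 0) := by
          refine hq.trans_tendsto ?_
          have : Continuous fun x : Fin N → ℝ => ‖x‖ ^ k := by fun_prop
          simpa [hk] using this.tendsto 0
        have h2 := tendsto_nhds_unique h1 (hc.tendsto.sub (hc2.tendsto 0))
        rw [h0, MvPolynomial.eval_zero] at h2
        simpa using h2
      refine ⟨fun d : DD k N => MvPolynomial.coeff (expo d.1) q, ?_⟩
      rw [SS_coeff (k := k) q hqd hq0]
      exact hq
  choose a ha using hj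
  refine ⟨a, isLittleO_pi.2 fun j => (ha j).congr_left fun x => ?_⟩
  rw [eval_SS]
  rfl

noncomputable def jt (k : ℕ) {N P : ℕ} (f : (Fin N → ℝ) → Fin P → ℝ) : EE k N P :=
  open Classical in if h : ∃ a : EE k N P, HJ f a then h.choose else 0

theorem jt_spec (k : ℕ) {N P : ℕ} {f : (Fin N → ℝ) → Fin P → ℝ} (hf : SmoothGermAtZero f)
    (h0 : f 0 = 0) : HJ f (jt k f) := by
  have h := exists_HJ (k := k) hf h0
  rw [jt, dif_pos h]
  exact h.choose_spec

theorem exists_linear_jt (k : ℕ) {N P : ℕ} {V : Type*} [AddCommGroup V] [Module ℝ V]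
    (Φ : V → (Fin N → ℝ) → Fin P → ℝ) (hadd : ∀ v w, Φ (v + w) = Φ v + Φ w)
    (hsmul : ∀ (c : ℝ) v, Φ (c • v) = c • Φ v)
    (hs : ∀ v, SmoothGermAtZero (Φ v)) (h0 : ∀ v, Φ v 0 = 0) :
    ∃ Λ : V →ₗ[ℝ] EE k N P, ∀ v, HJ (Φ v) (Λ v) := by
  have hj : ∀ v, HJ (Φ v) (jt k (Φ v)) := fun v => jt_spec k (hs v) (h0 v)
  refine ⟨{ toFun := fun v => jt k (Φ v), map_add' := ?_, map_smul' := ?_ }, hj⟩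
  · intro v w
    refine (hj _).unique ?_
    rw [hadd]
    exact (hj v).add (hj w)
  · intro c v
    refine (hj _).unique ?_
    rw [hsmul]
    exact (hj v).smul c


/-! ### The linear action of a contact germ on jets -/

theorem littleO_transport {k N P : ℕ} {h : (Fin N → ℝ) → Fin N → ℝ}
    {M : (Fin N → ℝ) → Matrix (Fin P) (Fin P) ℝ} (h0 : h 0 = 0)
    (hd : DifferentiableAt ℝ h 0) (hM : ∀ i j, ContinuousAt (fun x => M x i j) 0)
    {φ : (Fin N → ℝ) → Fin P → ℝ} (hφ : φ =o[𝓝 (0 : Fin N → ℝ)] fun x => ‖x‖ ^ k) :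
    (fun x => (M x).mulVec (φ (h x))) =o[𝓝 (0 : Fin N → ℝ)] fun x => ‖x‖ ^ k := by
  have hO : h =O[𝓝 (0 : Fin N → ℝ)] fun x => x := by
    have := hd.hasFDerivAt.isBigO_sub
    simpa [h0] using this
  have ht : Tendsto h (𝓝 0) (𝓝 0) := by
    have := hd.continuousAt.tendsto
    rwa [h0] at this
  have h1 : (fun x => φ (h x)) =o[𝓝 (0 : Fin N → ℝ)] fun x => ‖x‖ ^ k :=
    (hφ.comp_tendsto ht).trans_isBigO (hO.norm_norm.pow k)
  refine isLittleO_pi.2 fun i => ?_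
  simp only [Matrix.mulVec, dotProduct]
  refine IsLittleO.fun_sum fun j _ => ?_
  have h2 : (fun x => M x i j) =O[𝓝 (0 : Fin N → ℝ)] fun _ => (1 : ℝ) :=
    (hM i j).tendsto.isBigO_one ℝ
  have h3 := h2.mul_isLittleO (isLittleO_pi.1 h1 j)
  simpa using h3

theorem exists_Psi (k : ℕ) {N P : ℕ} {h : (Fin N → ℝ) → Fin N → ℝ}
    {M : (Fin N → ℝ) → Matrix (Fin P) (Fin P) ℝ} (hh : DiffeoGermAtZero h)
    (hM : ∃ U ∈ 𝓝 (0 : Fin N → ℝ),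
      ContDiffOn ℝ (⊤ : ℕ∞) (fun x (i : Fin P) (j : Fin P) => M x i j) U)
    (hu : IsUnit (M 0)) :
    ∃ Ψ : EE k N P →ₗ[ℝ] EE k N P, Function.Surjective Ψ ∧
      ∀ (f : (Fin N → ℝ) → Fin P → ℝ) (b : EE k N P), HJ f b →
        HJ (fun x => (M x).mulVec (f (h x))) (Ψ b) := by
  obtain ⟨h0, ⟨V, hV, hhV⟩, hbij⟩ := hh
  obtain ⟨U, hU, hMU⟩ := hM
  have hMij : ∀ i j, ContDiffOn ℝ (⊤ : ℕ∞) (fun x => M x i j) U := fun i j =>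
    contDiffOn_pi.1 (contDiffOn_pi.1 hMU i) j
  have hMc : ∀ i j, ContinuousAt (fun x => M x i j) 0 := fun i j =>
    (hMij i j).continuousOn.continuousAt hU
  have hcd : ContDiffAt ℝ (⊤ : ℕ∞) h 0 := hhV.contDiffAt hV
  have hd : DifferentiableAt ℝ h 0 := hcd.differentiableAt (by simp)
  obtain ⟨Ψ, hΨ⟩ := exists_linear_jt k
    (fun (b : EE k N P) x => (M x).mulVec (ev b (h x)))
    (fun v w => by funext x; simp [ev_add, Matrix.mulVec_add])
    (fun c v => by funext x; simp [ev_smul, Matrix.mulVec_smul])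
    (fun v => by
      refine ⟨U ∩ V, inter_mem hU hV, ?_⟩
      refine contDiffOn_pi.2 fun i => ?_
      simp only [Matrix.mulVec, dotProduct]
      refine ContDiffOn.sum fun j _ => ?_
      refine ((hMij i j).mono Set.inter_subset_left).mul ?_
      have h1 := (ev_contDiff v).comp_contDiffOn (hhV.mono (Set.inter_subset_right (s := U)))
      exact contDiffOn_pi.1 h1 j)
    (fun v => by simp [h0, ev_zero])
  have hprop : ∀ (f : (Fin N → ℝ) → Fin P → ℝ) (b : EE k N P), HJ f b →
        HJ (fun x => (M x).mulVec (f (h x))) (Ψ b) := by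
    intro f b hf
    have h1 := littleO_transport h0 hd hMc hf
    refine (h1.add (hΨ b)).congr_left fun x => ?_
    simp only [Matrix.mulVec_sub]
    abel
  refine ⟨Ψ, ?_, hprop⟩
  rw [← LinearMap.injective_iff_surjective, injective_iff_map_eq_zero]
  intro v hv
  have h1 := hΨ v
  rw [hv] at h1
  have h2 : (fun x => (M x).mulVec (ev v (h x))) =o[𝓝 (0 : Fin N → ℝ)] fun x => ‖x‖ ^ k := by
    refine IsLittleO.congr_left h1 fun x => ?_
    have : ev (0 : EE k N P) x = 0 := by funext j; simp [ev]
    rw [this, sub_zero]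
  have hst : HasStrictFDerivAt h (fderiv ℝ h 0) 0 := hcd.hasStrictFDerivAt (by simp)
  let e : (Fin N → ℝ) ≃L[ℝ] (Fin N → ℝ) :=
    (LinearEquiv.ofBijective (fderiv ℝ h 0 : (Fin N → ℝ) →ₗ[ℝ] (Fin N → ℝ)) hbij).toContinuousLinearEquiv
  have hst' : HasStrictFDerivAt h (e : (Fin N → ℝ) →L[ℝ] (Fin N → ℝ)) 0 := by
    have : (e : (Fin N → ℝ) →L[ℝ] (Fin N → ℝ)) = fderiv ℝ h 0 := by ext x; rfl
    rwa [this]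
  let g := hst'.localInverse h e 0
  have hg : HasStrictFDerivAt g (e.symm : (Fin N → ℝ) →L[ℝ] (Fin N → ℝ)) 0 := by
    have := hst'.to_localInverse
    rwa [h0] at this
  have hg0 : g 0 = 0 := by
    have := hst'.localInverse_apply_image
    rwa [h0] at this
  have hgr : ∀ᶠ y in 𝓝 (0 : Fin N → ℝ), h (g y) = y := by
    have := hst'.eventually_right_inverse
    rwa [h0] at this
  have hMmat : ContinuousAt M 0 := by
    refine continuousAt_pi.2 fun i => continuousAt_pi.2 fun j => hMc i j
  have hdet : ContinuousAt (fun x => (M x).det) 0 := by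
    have hc : Continuous fun A : Matrix (Fin P) (Fin P) ℝ => A.det := continuous_id.matrix_det
    exact hc.continuousAt.comp hMmat
  have hdet0 : (M 0).det ≠ 0 := ((Matrix.isUnit_iff_isUnit_det _).1 hu).ne_zero
  have hinv : ∀ i j, ContinuousAt (fun x => (M x)⁻¹ i j) 0 := by
    intro i j
    have hadj : ContinuousAt (fun x => (M x).adjugate i j) 0 := by
      have hc : Continuous fun A : Matrix (Fin P) (Fin P) ℝ => A.adjugate i j :=
        (continuous_id.matrix_adjugate).matrix_elem i j
      exact hc.continuousAt.comp hMmat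
    have : (fun x => (M x)⁻¹ i j) = fun x => (M x).det⁻¹ * (M x).adjugate i j := by
      funext x
      simp [Matrix.inv_def, Ring.inverse_eq_inv']
    rw [this]
    exact (hdet.inv₀ hdet0).mul hadj
  have h3 := littleO_transport (h := fun x => x) (M := fun x => (M x)⁻¹) rfl
    differentiableAt_id hinv h2
  have h4 : (fun x => ev v (h x)) =o[𝓝 (0 : Fin N → ℝ)] fun x => ‖x‖ ^ k := by
    refine h3.congr' ?_ EventuallyEq.rfl
    filter_upwards [hdet.eventually_ne hdet0] with x hx
    rw [Matrix.mulVec_mulVec, Matrix.nonsing_inv_mul _ (isUnit_iff_ne_zero.2 hx), Matrix.one_mulVec]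
  have h5 := littleO_transport (h := g) (M := fun _ => 1) hg0
    hg.hasFDerivAt.differentiableAt (fun i j => continuousAt_const) h4
  refine ev_littleO (h5.congr' ?_ EventuallyEq.rfl)
  filter_upwards [hgr] with y hy
  rw [hy, Matrix.one_mulVec]


/-! ### The stabilization and division -/

theorem iPlusOne_castSucc {k n p : ℕ} (hk : 1 ≤ k) (z : JetSpace k n p) (j : Fin p) :
    (iPlusOne hk z).1 (Fin.castSucc j) = MvPolynomial.rename Fin.castSucc (z.1 j) := by
  simp [iPlusOne]

theorem iPlusOne_last {k n p : ℕ} (hk : 1 ≤ k) (z : JetSpace k n p) :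
    (iPlusOne hk z).1 (Fin.last p) = MvPolynomial.X (Fin.last n) := by
  simp [iPlusOne]

theorem iPlus_castAdd {k n p : ℕ} (hk : 1 ≤ k) (z : JetSpace k n p) (j : Fin p) : ∀ m : ℕ,
    (iPlus hk m z).1 (Fin.castAdd m j) = MvPolynomial.rename (Fin.castAdd m) (z.1 j) := by
  intro m
  induction m with
  | zero =>
    have : (Fin.castAdd 0 : Fin n → Fin (n + 0)) = id := rfl
    rw [this, MvPolynomial.rename_id]
    rfl
  | succ m ih =>
    have h1 : (iPlus hk (m + 1) z).1 (Fin.castAdd (m + 1) j)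
        = MvPolynomial.rename Fin.castSucc ((iPlus hk m z).1 (Fin.castAdd m j)) :=
      iPlusOne_castSucc hk (iPlus hk m z) (Fin.castAdd m j)
    rw [h1, ih, MvPolynomial.rename_rename]
    rfl

theorem iPlus_natAdd {k n p : ℕ} (hk : 1 ≤ k) (z : JetSpace k n p) : ∀ (m : ℕ) (i : Fin m),
    (iPlus hk m z).1 (Fin.natAdd p i) = MvPolynomial.X (Fin.natAdd n i) := by
  intro m
  induction m with
  | zero => exact fun i => i.elim0
  | succ m ih =>
    intro i
    refine Fin.lastCases ?_ (fun i => ?_) i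
    · exact iPlusOne_last hk (iPlus hk m z)
    · refine (iPlusOne_castSucc hk (iPlus hk m z) (Fin.natAdd p i)).trans ?_
      rw [ih, MvPolynomial.rename_X]
      rfl

theorem iPlus_eval {k n p : ℕ} (hk : 1 ≤ k) (m : ℕ) (z : JetSpace k n p) (y : Fin (n + m) → ℝ) :
    (iPlus hk m z).eval y
      = Fin.append (z.eval fun i => y (Fin.castAdd m i)) (fun i => y (Fin.natAdd n i)) := by
  funext j
  refine Fin.addCases (fun j => ?_) (fun i => ?_) j
  · rw [Fin.append_left, JetSpace.eval, iPlus_castAdd, MvPolynomial.eval_rename]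
    rfl
  · rw [Fin.append_right, JetSpace.eval, iPlus_natAdd, MvPolynomial.eval_X]

noncomputable def evC {k N : ℕ} (A : (Fin N → Fin (k + 1)) → ℝ) (y : Fin N → ℝ) : ℝ :=
  ∑ e, A e * ∏ i, y i ^ (e i : ℕ)

theorem evC_contDiff {k N : ℕ} (A : (Fin N → Fin (k + 1)) → ℝ) :
    ContDiff ℝ (⊤ : ℕ∞) (evC A) := by
  unfold evC
  fun_prop

theorem evC_add {k N : ℕ} (A B : (Fin N → Fin (k + 1)) → ℝ) (y : Fin N → ℝ) :
    evC (A + B) y = evC A y + evC B y := by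
  simp [evC, add_mul, Finset.sum_add_distrib]

theorem evC_smul {k N : ℕ} (c : ℝ) (A : (Fin N → Fin (k + 1)) → ℝ) (y : Fin N → ℝ) :
    evC (c • A) y = c * evC A y := by
  simp [evC, mul_assoc, Finset.mul_sum]

theorem evC_sum {k N : ℕ} {ι : Type*} (s : Finset ι) (c : ι → ℝ)
    (A : ι → (Fin N → Fin (k + 1)) → ℝ) (y : Fin N → ℝ) :
    evC (fun e => ∑ d ∈ s, c d * A d e) y = ∑ d ∈ s, c d * evC (A d) y := by
  simp only [evC, Finset.mul_sum, Finset.sum_mul]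
  rw [Finset.sum_comm]
  exact Finset.sum_congr rfl fun _ _ => Finset.sum_congr rfl fun _ _ => by ring

theorem hadamard_mono {k n m : ℕ} (d : DD k (n + m)) :
    ∃ (z : DD k n → ℝ) (A : Fin m → (Fin (n + m) → Fin (k + 1)) → ℝ), ∀ y : Fin (n + m) → ℝ,
      ∏ i, y i ^ (d.1 i : ℕ) = (∑ e, z e * ∏ i, y (Fin.castAdd m i) ^ (e.1 i : ℕ))
        + ∑ i, evC (A i) y * y (Fin.natAdd n i) := by
  classical
  by_cases hd : ∀ i : Fin m, (d.1 (Fin.natAdd n i) : ℕ) = 0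
  · have hs : ∑ i, (d.1 i : ℕ) = ∑ i : Fin n, (d.1 (Fin.castAdd m i) : ℕ) := by
      rw [Fin.sum_univ_add]
      simp [hd]
    refine ⟨Pi.single ⟨fun i => d.1 (Fin.castAdd m i), by rw [← hs]; exact d.2⟩ 1, 0, fun y => ?_⟩
    rw [Finset.sum_eq_single ⟨fun i => d.1 (Fin.castAdd m i), by rw [← hs]; exact d.2⟩]
    · rw [Fin.prod_univ_add]
      simp [hd, evC]
    · intro b _ hb
      rw [Pi.single_eq_of_ne hb, zero_mul]
    · simp
  · push Not at hd
    obtain ⟨i, hi⟩ := hd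
    let e : Fin (n + m) → Fin (k + 1) := Function.update d.1 (Fin.natAdd n i)
      ⟨(d.1 (Fin.natAdd n i) : ℕ) - 1, by have := (d.1 (Fin.natAdd n i)).2; omega⟩
    refine ⟨0, Pi.single i (Pi.single e 1), fun y => ?_⟩
    have h1 : evC (Pi.single e (1 : ℝ)) y = ∏ i, y i ^ (e i : ℕ) := by
      rw [evC, Finset.sum_eq_single e]
      · simp
      · intro b _ hb
        rw [Pi.single_eq_of_ne hb, zero_mul]
      · simp
    rw [Finset.sum_eq_single i]
    · rw [Pi.single_eq_same, h1]
      simp only [Pi.zero_apply, zero_mul, Finset.sum_const_zero, zero_add]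
      rw [← Finset.mul_prod_erase _ _ (Finset.mem_univ (Fin.natAdd n i)),
        ← Finset.mul_prod_erase _ (fun j => y j ^ (e j : ℕ)) (Finset.mem_univ (Fin.natAdd n i))]
      have h2 : ∏ j ∈ Finset.univ.erase (Fin.natAdd n i), y j ^ (e j : ℕ)
          = ∏ j ∈ Finset.univ.erase (Fin.natAdd n i), y j ^ (d.1 j : ℕ) := by
        refine Finset.prod_congr rfl fun j hj => ?_
        simp only [e]
        rw [Function.update_of_ne (Finset.ne_of_mem_erase hj)]
      have h3 : (e (Fin.natAdd n i) : ℕ) + 1 = d.1 (Fin.natAdd n i) := by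
        simp only [e, Function.update_self]
        omega
      rw [h2, ← h3, pow_succ]
      ring
    · intro b _ hb
      rw [Pi.single_eq_of_ne hb]
      simp [evC]
    · simp

theorem hadamard {k n m : ℕ} (c : DD k (n + m) → ℝ) :
    ∃ (z : DD k n → ℝ) (A : Fin m → (Fin (n + m) → Fin (k + 1)) → ℝ), ∀ y : Fin (n + m) → ℝ,
      ∑ d, c d * ∏ i, y i ^ (d.1 i : ℕ) = (∑ e, z e * ∏ i, y (Fin.castAdd m i) ^ (e.1 i : ℕ))
        + ∑ i, evC (A i) y * y (Fin.natAdd n i) := by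
  choose z A h using fun d : DD k (n + m) => hadamard_mono d
  refine ⟨fun e => ∑ d, c d * z d e, fun i e => ∑ d, c d * A d i e, fun y => ?_⟩
  simp only [evC_sum Finset.univ c (fun d => A d _), h, mul_add, Finset.sum_add_distrib,
    Finset.mul_sum, Finset.sum_mul]
  congr 1
  · rw [Finset.sum_comm]
    exact Finset.sum_congr rfl fun _ _ => Finset.sum_congr rfl fun _ _ => by ring
  · rw [Finset.sum_comm]
    exact Finset.sum_congr rfl fun _ _ => Finset.sum_congr rfl fun _ _ => by ring


theorem contDiff_append {N a b : ℕ} {f : (Fin N → ℝ) → Fin a → ℝ} {g : (Fin N → ℝ) → Fin b → ℝ}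
    (hf : ContDiff ℝ (⊤ : ℕ∞) f) (hg : ContDiff ℝ (⊤ : ℕ∞) g) :
    ContDiff ℝ (⊤ : ℕ∞) (fun x => Fin.append (f x) (g x)) := by
  refine contDiff_pi.2 fun j => ?_
  refine Fin.addCases (fun j => ?_) (fun i => ?_) j
  · simp only [Fin.append_left]
    exact contDiff_pi.1 hf j
  · simp only [Fin.append_right]
    exact contDiff_pi.1 hg i

theorem smoothGerm_of_contDiff {N P : ℕ} {f : (Fin N → ℝ) → Fin P → ℝ}
    (hf : ContDiff ℝ (⊤ : ℕ∞) f) : SmoothGermAtZero f :=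
  ⟨Set.univ, univ_mem, hf.contDiffOn⟩

theorem append_ext {a b : ℕ} {f : Fin a → ℝ} {g : Fin b → ℝ} {w : Fin (a + b) → ℝ}
    (h1 : ∀ i, f i = w (Fin.castAdd b i)) (h2 : ∀ i, g i = w (Fin.natAdd a i)) :
    Fin.append f g = w := by
  funext j
  refine Fin.addCases (fun j => ?_) (fun i => ?_) j
  · rw [Fin.append_left, h1]
  · rw [Fin.append_right, h2]

/-- Parameters: `u`, `z`, `A`. -/
abbrev XX (k n p m : ℕ) : Type :=
  EE k (n + m) m × EE k n p × (Fin p → Fin m → (Fin (n + m) → Fin (k + 1)) → ℝ)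

noncomputable def fL {k n p m : ℕ} (x : XX k n p m) (y : Fin (n + m) → ℝ) : Fin (p + m) → ℝ :=
  Fin.append (ev x.2.1 fun i => y (Fin.castAdd m i)) (ev x.1 y)

noncomputable def fB {k n p m : ℕ} (A : Fin p → Fin m → (Fin (n + m) → Fin (k + 1)) → ℝ)
    (u : EE k (n + m) m) (y : Fin (n + m) → ℝ) : Fin (p + m) → ℝ :=
  Fin.append (fun j => ∑ i, evC (A j i) y * ev u y i) 0

theorem fL_contDiff {k n p m : ℕ} (x : XX k n p m) : ContDiff ℝ (⊤ : ℕ∞) (fL x) := by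
  refine contDiff_append ((ev_contDiff x.2.1).comp ?_) (ev_contDiff x.1)
  fun_prop

theorem fB_contDiff {k n p m : ℕ} (A : Fin p → Fin m → (Fin (n + m) → Fin (k + 1)) → ℝ)
    (u : EE k (n + m) m) : ContDiff ℝ (⊤ : ℕ∞) (fB A u) := by
  refine contDiff_append (contDiff_pi.2 fun j => ?_) contDiff_const
  refine ContDiff.sum fun i _ => ?_
  exact (evC_contDiff _).mul (contDiff_pi.1 (ev_contDiff u) i)

theorem fL_zero {k n p m : ℕ} (x : XX k n p m) : fL x 0 = 0 := by
  refine append_ext (fun i => ?_) (fun i => ?_)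
  · exact congrFun (ev_zero x.2.1) i
  · exact congrFun (ev_zero x.1) i

theorem fB_zero {k n p m : ℕ} (A : Fin p → Fin m → (Fin (n + m) → Fin (k + 1)) → ℝ)
    (u : EE k (n + m) m) : fB A u 0 = 0 := by
  refine append_ext (fun i => ?_) (fun i => rfl)
  simp [ev_zero]

theorem exists_F (k n p m : ℕ) (hk : 1 ≤ k) (u0 : EE k (n + m) m)
    (hu0 : ∀ y i, ev u0 y i = y (Fin.natAdd n i)) (z0 : EE k n p) :
    ∃ F : XX k n p m → EE k (n + m) (p + m), (∀ x, HJ (fL x + fB x.2.2 x.1) (F x)) ∧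
      Filter.map F (𝓝 (u0, z0, 0)) = 𝓝 (F (u0, z0, 0)) := by
  obtain ⟨L, hL⟩ := exists_linear_jt k (fL : XX k n p m → _)
    (fun v w => by
      funext y
      refine append_ext (fun i => ?_) (fun i => ?_)
      · simp [fL, ev_add]
      · simp [fL, ev_add])
    (fun c v => by
      funext y
      refine append_ext (fun i => ?_) (fun i => ?_)
      · simp [fL, ev_smul]
      · simp [fL, ev_smul])
    (fun v => smoothGerm_of_contDiff (fL_contDiff v)) fL_zero
  have hj : ∀ A (u : EE k (n + m) m), HJ (fB A u : _ → Fin (p + m) → ℝ) (jt k (fB A u)) :=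
    fun A u => jt_spec k (smoothGerm_of_contDiff (fB_contDiff A u)) (fB_zero A u)
  let β : (Fin p → Fin m → (Fin (n + m) → Fin (k + 1)) → ℝ) →ₗ[ℝ] EE k (n + m) m →ₗ[ℝ]
      EE k (n + m) (p + m) := LinearMap.mk₂ ℝ (fun A u => jt k (fB A u))
    (fun A B u => by
      refine (hj _ _).unique ?_
      have : fB (A + B) u = fB A u + fB B u := by
        funext y
        refine append_ext (fun i => ?_) (fun i => ?_)
        · simp [fB, evC_add, add_mul, Finset.sum_add_distrib]
        · simp [fB]
      rw [this]
      exact (hj A u).add (hj B u))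
    (fun c A u => by
      refine (hj _ _).unique ?_
      have : fB (c • A) u = c • fB A u := by
        funext y
        refine append_ext (fun i => ?_) (fun i => ?_)
        · simp [fB, evC_smul, mul_assoc, Finset.mul_sum]
        · simp [fB]
      rw [this]
      exact (hj A u).smul c)
    (fun A u v => by
      refine (hj _ _).unique ?_
      have : fB A (u + v) = fB A u + fB A v := by
        funext y
        refine append_ext (fun i => ?_) (fun i => ?_)
        · simp [fB, ev_add, mul_add, Finset.sum_add_distrib]
        · simp [fB]
      rw [this]
      exact (hj A u).add (hj A v))
    (fun c A u => by
      refine (hj _ _).unique ?_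
      have : fB A (c • u) = c • fB A u := by
        funext y
        refine append_ext (fun i => ?_) (fun i => ?_)
        · simp only [fB, ev_smul, Pi.smul_apply, smul_eq_mul, Fin.append_left, Finset.mul_sum]
          exact Finset.sum_congr rfl fun _ _ => by ring
        · simp [fB]
      rw [this]
      exact (hj A u).smul c)
  have hβ : ∀ A u, HJ (fB A u) (β A u) := hj
  let βc : (Fin p → Fin m → (Fin (n + m) → Fin (k + 1)) → ℝ) →L[ℝ] EE k (n + m) m →L[ℝ]
      EE k (n + m) (p + m) :=
    LinearMap.toContinuousLinearMap
      ((LinearMap.toContinuousLinearMap (𝕜 := ℝ) (E := EE k (n + m) m)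
        (F' := EE k (n + m) (p + m))).toLinearMap ∘ₗ β)
  have hβc : ∀ A u, βc A u = β A u := fun A u => rfl
  let Lc : XX k n p m →L[ℝ] EE k (n + m) (p + m) := LinearMap.toContinuousLinearMap L
  refine ⟨fun x => Lc x + βc x.2.2 x.1, fun x => (hL x).add (hβ x.2.2 x.1), ?_⟩
  let A' : XX k n p m →L[ℝ] (Fin p → Fin m → (Fin (n + m) → Fin (k + 1)) → ℝ) :=
    (ContinuousLinearMap.snd ℝ _ _).comp (ContinuousLinearMap.snd ℝ _ _)
  let u' : XX k n p m →L[ℝ] EE k (n + m) m := ContinuousLinearMap.fst ℝ _ _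
  have h1 : HasStrictFDerivAt (fun x : XX k n p m => βc (A' x)) (βc.comp A') (u0, z0, 0) :=
    (βc.comp A').hasStrictFDerivAt
  have h2 : HasStrictFDerivAt (fun x : XX k n p m => u' x) u' (u0, z0, 0) := u'.hasStrictFDerivAt
  have h3 := Lc.hasStrictFDerivAt.fun_add (h1.clm_apply h2)
  refine h3.map_nhds_eq_of_surj ?_
  rw [LinearMap.range_eq_top]
  intro b
  choose z A hzA using fun j : Fin p => hadamard (n := n) (m := m) (b (Fin.castAdd m j))
  refine ⟨(fun i => b (Fin.natAdd p i), z, A), ?_⟩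
  have h4 : HJ (fL ((fun i => b (Fin.natAdd p i), z, A) : XX k n p m) + fB A u0)
      (L (fun i => b (Fin.natAdd p i), z, A) + β A u0) := (hL _).add (hβ _ _)
  have h5 : fL ((fun i => b (Fin.natAdd p i), z, A) : XX k n p m) + fB A u0 = ev b := by
    funext y j
    refine Fin.addCases (fun j => ?_) (fun i => ?_) j
    · simp only [fL, fB, Pi.add_apply, Fin.append_left, hu0]
      exact (hzA j y).symm
    · simp only [fL, fB, Pi.add_apply, Fin.append_right, Pi.zero_apply, add_zero]
      rfl
  rw [h5] at h4
  have h6 := (HJ_ev b).unique h4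
  refine Eq.trans ?_ h6.symm
  have h7 : βc (A' ((u0, z0, 0) : XX k n p m)) = 0 := by
    have : A' ((u0, z0, 0) : XX k n p m) = 0 := rfl
    rw [this, map_zero]
  simp only [ContinuousLinearMap.coe_coe, add_apply]
  rw [h7]
  simp [Lc, A', u', hβc]

noncomputable def hU {k n m : ℕ} (u : EE k (n + m) m) (y : Fin (n + m) → ℝ) : Fin (n + m) → ℝ :=
  Fin.append (fun i => y (Fin.castAdd m i)) (ev u y)

theorem hU_contDiff {k n m : ℕ} (u : EE k (n + m) m) : ContDiff ℝ (⊤ : ℕ∞) (hU u) :=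
  contDiff_append (by fun_prop) (ev_contDiff u)

theorem hU_zero {k n m : ℕ} (u : EE k (n + m) m) : hU u 0 = 0 :=
  append_ext (fun _ => rfl) (fun i => congrFun (ev_zero u) i)

theorem hU_bij {k n m : ℕ} (u0 : EE k (n + m) m)
    (hu0 : ∀ y i, ev u0 y i = y (Fin.natAdd n i)) :
    ∀ᶠ u in 𝓝 u0, Function.Bijective (fderiv ℝ (hU u) 0) := by
  let g (u : EE k (n + m) m) (y : Fin (n + m) → ℝ) : Fin (n + m) → ℝ :=
    Fin.append (0 : Fin n → ℝ) (ev u y)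
  have hg : ∀ u, DifferentiableAt ℝ (g u) 0 := fun u =>
    (contDiff_append contDiff_const (ev_contDiff u)).contDiffAt.differentiableAt (by simp)
  let Λ : EE k (n + m) m →ₗ[ℝ] ((Fin (n + m) → ℝ) →L[ℝ] (Fin (n + m) → ℝ)) :=
    { toFun := fun u => fderiv ℝ (g u) 0
      map_add' := fun u v => by
        rw [← fderiv_add (hg u) (hg v)]
        congr 1
        funext y
        refine append_ext (fun i => ?_) (fun i => ?_)
        · simp [g]
        · simp [g, ev_add]
      map_smul' := fun c u => by
        rw [RingHom.id_apply, ← fderiv_const_smul (hg u) c]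
        congr 1
        funext y
        refine append_ext (fun i => ?_) (fun i => ?_)
        · simp [g]
        · simp [g, ev_smul] }
  let f (y : Fin (n + m) → ℝ) : Fin (n + m) → ℝ :=
    Fin.append (fun i => y (Fin.castAdd m i)) (0 : Fin m → ℝ)
  have hf : DifferentiableAt ℝ f 0 :=
    (contDiff_append (N := n + m) (by fun_prop) contDiff_const).contDiffAt.differentiableAt
      (n := (⊤ : ℕ∞)) (by simp)
  have hfd : ∀ u, fderiv ℝ (hU u) 0 = fderiv ℝ f 0 + Λ u := by
    intro u
    have : hU u = f + g u := by
      funext y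
      refine append_ext (fun i => ?_) (fun i => ?_)
      · simp [f, g]
      · simp [f, g]
    rw [this, fderiv_add hf (hg u)]
    rfl
  have hcont : Continuous fun u : EE k (n + m) m => fderiv ℝ (hU u) 0 := by
    simp only [hfd]
    exact continuous_const.add Λ.continuous_of_finiteDimensional
  have hid : hU u0 = id := by
    funext y
    exact append_ext (fun _ => rfl) (fun i => hu0 y i)
  have hopen := (Units.isOpen (R := (Fin (n + m) → ℝ) →L[ℝ] (Fin (n + m) → ℝ))).preimage hcont
  have hmem : u0 ∈ (fun u : EE k (n + m) m => fderiv ℝ (hU u) 0) ⁻¹'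
      {x : (Fin (n + m) → ℝ) →L[ℝ] (Fin (n + m) → ℝ) | IsUnit x} := by
    simp only [Set.mem_preimage, Set.mem_ofPred_eq, hid, fderiv_id]
    exact isUnit_one
  filter_upwards [hopen.mem_nhds hmem] with u hu
  exact ContinuousLinearMap.isUnit_iff_bijective.1 hu

noncomputable def BB {k n p m : ℕ} (A : Fin p → Fin m → (Fin (n + m) → Fin (k + 1)) → ℝ)
    (y : Fin (n + m) → ℝ) : Matrix (Fin (p + m)) (Fin (p + m)) ℝ :=
  (Matrix.fromBlocks 1 (Matrix.of fun j i => evC (A j i) y) 0 1).submatrix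
    finSumFinEquiv.symm finSumFinEquiv.symm

theorem BB_unit {k n p m : ℕ} (A : Fin p → Fin m → (Fin (n + m) → Fin (k + 1)) → ℝ)
    (y : Fin (n + m) → ℝ) : IsUnit (BB A y) := by
  rw [Matrix.isUnit_iff_isUnit_det, BB, Matrix.det_submatrix_equiv_self,
    Matrix.det_fromBlocks_zero₂₁]
  simp

theorem BB_contDiff {k n p m : ℕ} (A : Fin p → Fin m → (Fin (n + m) → Fin (k + 1)) → ℝ)
    (a b : Fin (p + m)) : ContDiff ℝ (⊤ : ℕ∞) (fun y => BB A y a b) := by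
  refine Fin.addCases (fun a => ?_) (fun a => ?_) a <;>
  refine Fin.addCases (fun b => ?_) (fun b => ?_) b <;>
  simp only [BB, Matrix.submatrix_apply, finSumFinEquiv_symm_apply_castAdd,
    finSumFinEquiv_symm_apply_natAdd, Matrix.fromBlocks_apply₁₁, Matrix.fromBlocks_apply₁₂,
    Matrix.fromBlocks_apply₂₁, Matrix.fromBlocks_apply₂₂, Matrix.of_apply]
  · exact contDiff_const
  · exact evC_contDiff _
  · exact contDiff_const
  · exact contDiff_const

theorem BB_mulVec {k n p m : ℕ} (hk : 1 ≤ k) (x : XX k n p m) (y : Fin (n + m) → ℝ) :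
    (BB x.2.2 y).mulVec ((iPlus hk m (JJ x.2.1)).eval (hU x.1 y)) = (fL x + fB x.2.2 x.1) y := by
  rw [iPlus_eval, eval_JJ]
  funext a
  refine Fin.addCases (fun a => ?_) (fun a => ?_) a
  · simp [Matrix.mulVec, dotProduct, Fin.sum_univ_add, BB, hU, fL, fB, Matrix.one_apply]
  · simp [Matrix.mulVec, dotProduct, Fin.sum_univ_add, BB, hU, fL, fB, Matrix.one_apply]

theorem eval_contDiff {k N P : ℕ} (w : JetSpace k N P) : ContDiff ℝ (⊤ : ℕ∞) w.eval := by
  rw [← eval_cf]; exact ev_contDiff _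

theorem eval_zero_jet {k N P : ℕ} (w : JetSpace k N P) : w.eval 0 = 0 := by
  rw [← eval_cf]; exact ev_zero _


/-! ### Statement: Lemma 5.2 -/

/-- **Lemma 5.2** (Ando). Let `Ω(n,p)` be a `𝒦`-invariant open subset of
`J^k(n,p)` and `m > 0`.  Then `Ω_𝒦(n+m,p+m)`, the union of the `𝒦`-orbits
`𝒦(i_{+m}(z))` for `z ∈ Ω(n,p)`, is open in `J^k(n+m,p+m)`. -/
theorem lemma_5_2 (k n p m : ℕ) (hk : 1 ≤ k) (hm : 0 < m)
    (Ω : Set (JetSpace k n p)) (hΩopen : IsOpen Ω) (hΩinv : KInvariant Ω) :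
    IsOpen (OmegaK hk Ω m) := by
  suffices hO : IsOpen ((JJ : EE k (n + m) (p + m) → _) ⁻¹' OmegaK hk Ω m) by
    have : OmegaK hk Ω m = cf ⁻¹' ((JJ : EE k (n + m) (p + m) → _) ⁻¹' OmegaK hk Ω m) := by
      ext w
      simp only [Set.mem_preimage, JJ_cf]
    rw [this]
    exact hO.preimage continuous_cf
  rw [isOpen_iff_mem_nhds]
  rintro b0 ⟨z0, hz0, f, g, hf, hg, hf0, hg0, hjf, hjg, h, M, hh, hM, hMu, hgM⟩
  obtain ⟨Ψ, hΨs, hΨ⟩ := exists_Psi k hh hM hMu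
  let u0 : EE k (n + m) m := cf ⟨fun i => MvPolynomial.X (Fin.natAdd n i), fun i => by
    simpa using hk⟩
  have hu0 : ∀ y i, ev u0 y i = y (Fin.natAdd n i) := by
    intro y i
    have h1 := congrFun (congrFun (eval_cf (⟨fun i => MvPolynomial.X (Fin.natAdd n i), fun i => by
      simpa using hk⟩ : JetSpace k (n + m) m)) y) i
    refine h1.trans ?_
    simp [JetSpace.eval]
  obtain ⟨F, hF, hFn⟩ := exists_F k n p m hk u0 hu0 (cf z0)
  have hbase : Ψ (F (u0, cf z0, 0)) = b0 := by
    have h1 : cf (iPlus hk m z0) = F (u0, cf z0, 0) := by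
      refine (HJ_ev _).unique ?_
      have h2 := hF (u0, cf z0, 0)
      have h3 : fL (u0, cf z0, 0) + fB 0 u0 = ev (cf (iPlus hk m z0)) := by
        rw [eval_cf]
        funext y
        rw [iPlus_eval]
        symm
        refine append_ext (fun i => ?_) (fun i => ?_)
        · simp [fL, fB, evC, eval_cf]
        · simp [fL, fB, hu0]
      rwa [h3] at h2
    have h4 := hΨ f _ (HJ_cf.2 hjf)
    rw [h1] at h4
    refine h4.unique ?_
    refine IsLittleO.congr' (HJ_iff.1 hjg) ?_ EventuallyEq.rfl
    filter_upwards [hgM] with x hx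
    rw [hx]
  have hmap : Filter.map (fun x => Ψ (F x)) (𝓝 (u0, cf z0, 0)) = 𝓝 b0 := by
    have h1 : IsOpenMap (LinearMap.toContinuousLinearMap Ψ) :=
      ContinuousLinearMap.isOpenMap _ hΨs
    have h2 := h1.map_nhds_eq (LinearMap.toContinuousLinearMap Ψ).continuous.continuousAt
      (x := F (u0, cf z0, 0))
    rw [← hFn, Filter.map_map] at h2
    rw [← hbase]
    exact h2
  rw [← hmap, Filter.mem_map]
  have hΩ' : ∀ᶠ x : XX k n p m in 𝓝 (u0, cf z0, 0), JJ x.2.1 ∈ Ω := by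
    have hc : Continuous fun x : XX k n p m => JJ x.2.1 :=
      continuous_JJ.comp (continuous_fst.comp continuous_snd)
    refine (hΩopen.preimage hc).mem_nhds ?_
    simpa [JJ_cf] using hz0
  have hbij : ∀ᶠ x : XX k n p m in 𝓝 (u0, cf z0, 0), Function.Bijective (fderiv ℝ (hU x.1) 0) :=
    (continuous_fst.tendsto ((u0, cf z0, 0) : XX k n p m)).eventually (hU_bij u0 hu0)
  filter_upwards [hΩ', hbij] with x hx hxb
  obtain ⟨h0, ⟨V, hV, hhV⟩, hhb⟩ := hh
  obtain ⟨U, hUn, hMU⟩ := hM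
  have hMij : ∀ i j, ContDiffOn ℝ (⊤ : ℕ∞) (fun x => M x i j) U := fun i j =>
    contDiffOn_pi.1 (contDiffOn_pi.1 hMU i) j
  have hBh : ∀ i j, ContDiffOn ℝ (⊤ : ℕ∞) (fun y => BB x.2.2 (h y) i j) V := fun i j =>
    (BB_contDiff x.2.2 i j).comp_contDiffOn hhV
  have hMB : ∀ i j, ContDiffOn ℝ (⊤ : ℕ∞) (fun y => (M y * BB x.2.2 (h y)) i j) (U ∩ V) := by
    intro i j
    simp only [Matrix.mul_apply]
    refine ContDiffOn.sum fun l _ => ?_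
    exact ((hMij i l).mono Set.inter_subset_left).mul ((hBh l j).mono Set.inter_subset_right)
  have hhU : ContDiffOn ℝ (⊤ : ℕ∞) (fun y => hU x.1 (h y)) V :=
    (hU_contDiff x.1).comp_contDiffOn hhV
  refine ⟨JJ x.2.1, hx, (iPlus hk m (JJ x.2.1)).eval,
    fun y => (M y * BB x.2.2 (h y)).mulVec ((iPlus hk m (JJ x.2.1)).eval (hU x.1 (h y))),
    smoothGerm_of_contDiff (eval_contDiff _), ?_, eval_zero_jet _, ?_, ?_, ?_, ?_⟩
  · refine ⟨U ∩ V, inter_mem hUn hV, contDiffOn_pi.2 fun i => ?_⟩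
    simp only [Matrix.mulVec, dotProduct]
    refine ContDiffOn.sum fun j _ => (hMB i j).mul ?_
    have h1 := (eval_contDiff (iPlus hk m (JJ x.2.1))).comp_contDiffOn
      (hhU.mono (Set.inter_subset_right (s := U)))
    exact contDiffOn_pi.1 h1 j
  · simp only [h0, hU_zero, eval_zero_jet, Matrix.mulVec_zero]
  · rw [← HJ_cf, ← eval_cf]
    exact HJ_ev _
  · rw [HJ_iff]
    have h1 := hΨ _ _ (hF x)
    refine IsLittleO.congr_left h1 fun y => ?_
    beta_reduce
    rw [← Matrix.mulVec_mulVec, BB_mulVec]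
  · refine ⟨fun y => hU x.1 (h y), fun y => M y * BB x.2.2 (h y), ⟨?_, ⟨V, hV, hhU⟩, ?_⟩,
      ⟨U ∩ V, inter_mem hUn hV, contDiffOn_pi.2 fun i => contDiffOn_pi.2 fun j => hMB i j⟩,
      hMu.mul (BB_unit _ _), Eventually.of_forall fun y => rfl⟩
    · simp only [h0, hU_zero]
    · have hd : DifferentiableAt ℝ h 0 := (hhV.contDiffAt hV).differentiableAt (by simp)
      have hd2 : DifferentiableAt ℝ (hU x.1) (h 0) :=
        (hU_contDiff x.1).contDiffAt.differentiableAt (by simp)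
      have h1 : fderiv ℝ (fun y => hU x.1 (h y)) 0
          = (fderiv ℝ (hU x.1) 0).comp (fderiv ℝ h 0) := by
        have := fderiv_comp (0 : Fin (n + m) → ℝ) hd2 hd
        rw [h0] at this
        exact this
      rw [h1]
      exact hxb.comp hhb

end AndoCob
end
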